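/- For every K ≥ 1 there exists ε₀ > 0 with the following property. Let X be a metric space in which every ball of radius 4 can be covered by at most K balls of radius 1, and let Γ be a subgroup of the isometry group of X such that for every x ∈ X the set S₂(x) := {γ ∈ Γ : d(γ·x, x) < 2} is finite. Then for every x ∈ X and every ε with 0 < ε < ε₀, the subgroup of Γ generated by S_ε(x) := {γ ∈ Γ : d(γ·x, x) < ε} is virtually nilpotent. -/

import Mathlib

open Pointwise

/-- A group is virtually nilpotent if it has a nilpotent subgroup of finite index. -/
def IsVirtuallyNilpotent (G : Type*) [Group G] : Prop :=
  ∃ H : Subgroup G, H.FiniteIndex ∧ Group.IsNilpotent H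

open scoped commutatorElement

theorem isVirtuallyNilpotent_of_lowerCentralSeries_le {H : Type*} [Group H] (E : Subgroup H)
    [E.Normal] [Finite E] (k : ℕ) (h : (⊤ : Subgroup H).lowerCentralSeries k ≤ E) :
    IsVirtuallyNilpotent H := by
  have hq : Group.IsNilpotent (H ⧸ E) := by
    rw [Subgroup.nilpotent_iff_lowerCentralSeries]
    refine ⟨k, ?_⟩
    have h1 := Subgroup.map_lowerCentralSeries (⊤ : Subgroup H) (QuotientGroup.mk' E) k
    rw [← MonoidHom.range_eq_map, QuotientGroup.range_mk'] at h1
    rw [← h1, Subgroup.map_eq_bot_iff, QuotientGroup.ker_mk']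
    exact h
  have : Finite (MulAut E) := by
    have : Finite (E ≃ E) := inferInstance
    exact Finite.of_injective (fun f : MulAut E => f.toEquiv) fun a b h =>
      MulEquiv.toEquiv_injective h
  refine ⟨(MulAut.conjNormal : H →* MulAut E).ker, Subgroup.finiteIndex_ker _, ?_⟩
  refine Subgroup.isNilpotent_of_ker_le_center
    ((QuotientGroup.mk' E).comp (MulAut.conjNormal : H →* MulAut E).ker.subtype) ?_
  intro x hx
  have hxE : (x : H) ∈ E := by simpa using hx
  rw [Subgroup.mem_center_iff]
  rintro ⟨y, hy⟩
  ext
  have h1 := congrArg (fun f : MulAut E => ((f ⟨x, hxE⟩ : E) : H)) ((MonoidHom.mem_ker).1 hy)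
  simp only [MulAut.conjNormal_apply, MulAut.one_apply] at h1
  simpa using mul_inv_eq_iff_eq_mul.1 h1

/-- A group generated by a finite `N`-ball in which commutators contract the length function `N`
is virtually nilpotent. -/
theorem isVirtuallyNilpotent_closure_of_commutator_le {G : Type*} [Group G] (N : G → ℝ)
    (h0 : ∀ g, 0 ≤ N g) (h1 : N 1 = 0) (hinv : ∀ g, N g⁻¹ = N g)
    (hmul : ∀ g h, N (g * h) ≤ N g + N h)
    {c : ℝ} (hc : 0 < c) (hfin : {g | N g ≤ c}.Finite)
    (hcomm : ∀ g h, N g ≤ c → N h ≤ c → N ⁅g, h⁆ ≤ N g / 2) :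
    IsVirtuallyNilpotent (Subgroup.closure {g | N g ≤ c}) := by
  set H := Subgroup.closure {g | N g ≤ c} with hH
  let B : ℕ → Set H := fun j => {x | N x ≤ c / 2 ^ j}
  let S : ℕ → Subgroup H := fun j => Subgroup.closure (B j)
  have hBle : ∀ j x, x ∈ B j → N x ≤ c := fun j x hx =>
    le_trans hx (div_le_self hc.le (one_le_pow₀ (by norm_num)))
  have hS0 : S 0 = ⊤ := by
    have : B 0 = ((↑) : H → G) ⁻¹' {g | N g ≤ c} := by ext x; simp [B]
    simp only [S, this]
    exact Subgroup.closure_closure_coe_preimage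
  have hBcomm : ∀ j x y, x ∈ B j → y ∈ B 0 → ⁅x, y⁆ ∈ B (j + 1) := by
    intro j x y hx hy
    have := hcomm x y (hBle _ _ hx) (hBle _ _ hy)
    have hx' : N x ≤ c / 2 ^ j := hx
    change N ((⁅x, y⁆ : H) : G) ≤ c / 2 ^ (j + 1)
    have h3 : ((⁅x, y⁆ : H) : G) = ⁅(x : G), (y : G)⁆ := by simp [commutatorElement_def]
    rw [h3, pow_succ, ← div_div]
    linarith
  have hBanti : ∀ j, B (j + 1) ⊆ B j := by
    intro j x hx
    refine le_trans (b := c / 2 ^ (j + 1)) hx ?_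
    gcongr
    · norm_num
    · omega
  have hBinv : ∀ j x, x ∈ B j → x⁻¹ ∈ B j := by
    intro j x hx
    change N ((x⁻¹ : H) : G) ≤ _
    rw [Subgroup.coe_inv, hinv]
    exact hx
  have hnormal : ∀ j, (S j).Normal := by
    intro j
    refine ⟨fun n hn g => ?_⟩
    have hgt : g ∈ S 0 := hS0 ▸ Subgroup.mem_top g
    have key : ∀ g ∈ B 0, ∀ n ∈ S j, g * n * g⁻¹ ∈ S j := by
      intro g hg n hn
      induction hn using Subgroup.closure_induction with
      | mem x hx =>
        have h4 : ⁅x, g⁆⁻¹ * x = g * x * g⁻¹ := by simp [commutatorElement_def, mul_assoc]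
        rw [← h4]
        exact mul_mem (inv_mem (Subgroup.subset_closure (hBanti _ (hBcomm j x g hx hg))))
          (Subgroup.subset_closure hx)
      | one => simp
      | mul x y _ _ hx hy =>
        have : g * (x * y) * g⁻¹ = (g * x * g⁻¹) * (g * y * g⁻¹) := by simp [mul_assoc]
        rw [this]; exact mul_mem hx hy
      | inv x _ hx =>
        have : g * x⁻¹ * g⁻¹ = (g * x * g⁻¹)⁻¹ := by simp [mul_assoc]
        rw [this]; exact inv_mem hx
    induction hgt using Subgroup.closure_induction'' generalizing n with
    | mem x hx => exact key x hx n hn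
    | inv_mem x hx => exact key _ (hBinv _ _ hx) n hn
    | one => simpa
    | mul x y _ _ hx hy =>
      have : x * y * n * (x * y)⁻¹ = x * (y * n * y⁻¹) * x⁻¹ := by simp [mul_assoc]
      rw [this]
      exact hx _ (hy _ hn)
  have hlcs : ∀ j, (⊤ : Subgroup H).lowerCentralSeries j ≤ S j := by
    intro j
    induction j with
    | zero => rw [hS0]; exact le_top
    | succ j ih =>
      rw [Subgroup.lowerCentralSeries_succ]
      refine (Subgroup.commutator_mono ih le_top).trans ?_
      rw [Subgroup.commutator_le]
      rintro x hx y -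
      have hy : y ∈ S 0 := hS0 ▸ Subgroup.mem_top y
      have := hnormal (j + 1)
      have hiff : ∀ x y : H, Commute (x : H ⧸ S (j + 1)) (y : H ⧸ S (j + 1)) ↔
          ⁅x, y⁆ ∈ S (j + 1) := by
        intro x y
        rw [← QuotientGroup.eq_one_iff, ← commutatorElement_eq_one_iff_commute]
        rfl
      rw [← hiff]
      induction hx using Subgroup.closure_induction with
      | mem x hx =>
        induction hy using Subgroup.closure_induction with
        | mem y hy => exact (hiff _ _).2 (Subgroup.subset_closure (hBcomm j x y hx hy))
        | one => exact Commute.one_right _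
        | mul a b _ _ ha hb => exact Commute.mul_right ha hb
        | inv a _ ha => exact Commute.inv_right ha
      | one => exact Commute.one_left _
      | mul a b _ _ ha hb => exact Commute.mul_left ha hb
      | inv a _ ha => exact Commute.inv_left ha
  obtain ⟨j, hj⟩ : ∃ j : ℕ, ∀ g : G, N g ≤ c / 2 ^ j → N g = 0 := by
    have hne : ∃ m > 0, ∀ g : G, N g ≤ c → N g ≠ 0 → m ≤ N g := by
      obtain hs | hs := ({g | N g ≤ c} ∩ {g | N g ≠ 0}).eq_empty_or_nonempty
      · exact ⟨1, one_pos, fun g hg hg' => absurd (show g ∈ {g | N g ≤ c} ∩ {g | N g ≠ 0} from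
          ⟨hg, hg'⟩) (by simp [hs])⟩
      · obtain ⟨a, ha, hmin⟩ := Set.exists_min_image _ N (hfin.inter_of_left _) hs
        exact ⟨N a, lt_of_le_of_ne (h0 a) (Ne.symm ha.2), fun g hg hg' => hmin g ⟨hg, hg'⟩⟩
    obtain ⟨m, hm, hm'⟩ := hne
    obtain ⟨j, hj⟩ := pow_unbounded_of_one_lt (c / m) (one_lt_two)
    refine ⟨j, fun g hg => ?_⟩
    by_contra hg0
    have h5 : c / 2 ^ j < m := by
      rw [div_lt_iff₀ (by positivity)]
      rwa [div_lt_iff₀ hm, mul_comm] at hj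
    exact absurd (hm' g (hg.trans (div_le_self hc.le (one_le_pow₀ (by norm_num)))) hg0)
      (by linarith)
  have hfinS : Finite (S j) := by
    have hsub : ∀ x ∈ S j, N (x : G) = 0 := by
      intro x hx
      induction hx using Subgroup.closure_induction with
      | mem x hx => exact hj _ hx
      | one => exact h1
      | mul a b _ _ ha hb =>
        refine le_antisymm ?_ (h0 _)
        have := hmul a b
        rw [ha, hb] at this
        simpa using this
      | inv a _ ha => rw [Subgroup.coe_inv, hinv, ha]
    have : Finite {g | N g ≤ c} := hfin
    refine Finite.of_injective (fun x : S j => (⟨((x : H) : G), ?_⟩ : {g | N g ≤ c})) ?_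
    · change N _ ≤ c
      rw [hsub _ x.2]; exact hc.le
    · intro x y hxy
      exact Subtype.ext (Subtype.ext (Subtype.mk.inj hxy))
  have := hnormal j
  exact isVirtuallyNilpotent_of_lowerCentralSeries_le (S j) j (hlcs j)

section EscapeNorm

variable {G : Type*} [Group G] {N : G → ℝ} {c₀ c C : ℝ}

theorem escapeNorm_pow_le (h1 : N 1 = 0) (hmul : ∀ g h, N (g * h) ≤ N g + N h)
    (g : G) (n : ℕ) : N (g ^ n) ≤ n * N g := by
  induction n with
  | zero => simp [h1]
  | succ n ih =>
    rw [pow_succ]; push_cast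
    linarith [hmul (g ^ n) g]

theorem escapeNorm_conj_le (h0 : ∀ g, 0 ≤ N g) (h1 : N 1 = 0) (hinv : ∀ g, N g⁻¹ = N g)
    (hmul : ∀ g h, N (g * h) ≤ N g + N h) (hc₀ : 0 < c₀)
    (hesc : ∀ g (n : ℕ), (∀ i ≤ n, N (g ^ i) ≤ c₀) → n / 2 * N g ≤ N (g ^ n))
    {g h : G} (hh : N h ≤ c₀ / 8) (hg : N g ≤ c₀ / 4) : N (h * g * h⁻¹) ≤ 8 * N g := by
  have key : ∀ n : ℕ, n * N g ≤ c₀ / 2 → n / 2 * N (h * g * h⁻¹) ≤ 3 / 4 * c₀ := by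
    intro n hn
    have hle : ∀ i ≤ n, N ((h * g * h⁻¹) ^ i) ≤ 3 / 4 * c₀ := by
      intro i hi
      rw [conj_pow]
      have e1 := hmul (h * g ^ i) h⁻¹
      have e2 := hmul h (g ^ i)
      have e3 := escapeNorm_pow_le h1 hmul g i
      have e4 : (i : ℝ) * N g ≤ n * N g :=
        mul_le_mul_of_nonneg_right (by exact_mod_cast hi) (h0 g)
      rw [hinv] at e1
      linarith
    exact (hesc _ n fun i hi => (hle i hi).trans (by linarith)).trans (hle n le_rfl)
  rcases (h0 g).eq_or_lt with hg0 | hg0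
  · by_contra hcon
    rw [← hg0] at hcon
    have hpos : 0 < N (h * g * h⁻¹) := by linarith
    obtain ⟨n, hn⟩ := exists_nat_gt (2 * c₀ / N (h * g * h⁻¹))
    rw [div_lt_iff₀ hpos] at hn
    have := key n (by rw [← hg0]; linarith)
    linarith
  · have hr : 2 ≤ c₀ / (2 * N g) := by rw [le_div_iff₀ (by positivity)]; linarith
    have hfl := Nat.floor_le (show 0 ≤ c₀ / (2 * N g) by positivity)
    have hfl' := Nat.lt_floor_add_one (c₀ / (2 * N g))
    set n := ⌊c₀ / (2 * N g)⌋₊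
    have hk := key n (by
      rw [le_div_iff₀ (by positivity)] at hfl; linarith)
    have hn : c₀ / (2 * N g) / 2 ≤ n := by linarith
    have hn2 : c₀ ≤ 4 * n * N g := by
      rw [div_div, div_le_iff₀ (by positivity)] at hn; linarith
    have hnpos : (0 : ℝ) < n := by linarith
    have := h0 (h * g * h⁻¹)
    have e5 : (n : ℝ) * N (h * g * h⁻¹) ≤ n * (6 * N g) := by nlinarith
    have := le_of_mul_le_mul_left e5 hnpos
    linarith

theorem escapeNorm_sub_le (hinv : ∀ g, N g⁻¹ = N g)
    (hmul : ∀ g h, N (g * h) ≤ N g + N h) (g h : G) : |N (g * h) - N h| ≤ N g := by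
  rw [abs_le]
  have e1 := hmul g⁻¹ (g * h)
  rw [inv_mul_cancel_left, hinv] at e1
  constructor <;> linarith [hmul g h]

theorem escapeNorm_commutator_le (h0 : ∀ g, 0 ≤ N g) (h1 : N 1 = 0) (hinv : ∀ g, N g⁻¹ = N g)
    (hmul : ∀ g h, N (g * h) ≤ N g + N h) (hc₀ : 0 < c₀)
    (hesc : ∀ g (n : ℕ), (∀ i ≤ n, N (g ^ i) ≤ c₀) → n / 2 * N g ≤ N (g ^ n))
    (hc : 0 < c) (hcc : c ≤ c₀ / 16) (hfin : {g | N g ≤ 2 * c}.Finite) (hC : 0 ≤ C)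
    (hcard : ({g | N g ≤ 2 * c}.ncard : ℝ) ≤ C * {g | N g ≤ c / 2}.ncard)
    {g h : G} (hg : N g ≤ c) (hh : N h ≤ c) : N ⁅g, h⁆ ≤ 512 * C / c * N g * N h := by
  classical
  set B := hfin.toFinset with hB
  have memB : ∀ x, x ∈ B ↔ N x ≤ 2 * c := by simp [hB]
  set ψ : G → ℝ := fun x => max 0 (1 - N x / c) with hψ
  have ψ0 : ∀ x, 0 ≤ ψ x := fun x => le_max_left _ _
  have ψne : ∀ x, ψ x ≠ 0 → N x < c := by
    intro x hx
    by_contra hcon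
    refine hx (max_eq_left ?_)
    rw [sub_nonpos, le_div_iff₀ hc]; linarith
  have ψlip : ∀ x y, |ψ x - ψ y| ≤ |N x - N y| / c := by
    intro x y
    refine (abs_max_sub_max_le_max _ _ _ _).trans ?_
    rw [sub_self, abs_zero, max_eq_right (abs_nonneg _),
      show 1 - N x / c - (1 - N y / c) = -((N x - N y) / c) by ring, abs_neg, abs_div,
      abs_of_pos hc]
  set φ : G → ℝ := fun x => ∑ y ∈ B, ψ y * ψ (y⁻¹ * x) with hφ
  have hshift : ∀ h x, N h ≤ c → φ (h⁻¹ * x) = ∑ y ∈ B, ψ (h⁻¹ * y) * ψ (y⁻¹ * x) := by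
    intro h x hh
    simp only [hφ]
    rw [← finsum_eq_sum_of_support_subset, ← finsum_eq_sum_of_support_subset]
    · rw [← finsum_comp_equiv (Equiv.mulLeft h⁻¹)]
      simp [mul_assoc]
    · intro y hy
      have e1 := ψne _ (left_ne_zero_of_mul hy)
      have e2 := hmul h (h⁻¹ * y)
      rw [mul_inv_cancel_left] at e2
      exact (memB y).2 (by linarith)
    · intro y hy
      have e1 := ψne _ (left_ne_zero_of_mul hy)
      exact (memB y).2 (by linarith)
  have hsecond : ∀ a b x, N a ≤ c → N b ≤ c →
      |(φ (b⁻¹ * (a⁻¹ * x)) - φ (a⁻¹ * x)) - (φ (b⁻¹ * x) - φ x)| ≤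
        B.card * (8 * N a * N b / c ^ 2) := by
    intro a b x ha hb
    rw [hshift b _ hb, hshift b _ hb]
    simp only [hφ]
    rw [← Finset.sum_sub_distrib, ← Finset.sum_sub_distrib, ← Finset.sum_sub_distrib]
    refine (Finset.abs_sum_le_sum_abs _ _).trans ?_
    rw [← nsmul_eq_mul]
    refine Finset.sum_le_card_nsmul _ _ _ fun y hy => ?_
    have hy' := (memB y).1 hy
    have e0 : ψ (b⁻¹ * y) * ψ (y⁻¹ * (a⁻¹ * x)) - ψ y * ψ (y⁻¹ * (a⁻¹ * x)) -
        (ψ (b⁻¹ * y) * ψ (y⁻¹ * x) - ψ y * ψ (y⁻¹ * x)) =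
        (ψ (b⁻¹ * y) - ψ y) * (ψ (y⁻¹ * (a⁻¹ * x)) - ψ (y⁻¹ * x)) := by ring
    have e1 : |ψ (b⁻¹ * y) - ψ y| ≤ N b / c := by
      refine (ψlip _ _).trans ?_
      gcongr
      simpa [hinv] using escapeNorm_sub_le hinv hmul b⁻¹ y
    have e2 : |ψ (y⁻¹ * (a⁻¹ * x)) - ψ (y⁻¹ * x)| ≤ 8 * N a / c := by
      refine (ψlip _ _).trans ?_
      gcongr
      have e3 : y⁻¹ * (a⁻¹ * x) = (y⁻¹ * a⁻¹ * y⁻¹⁻¹) * (y⁻¹ * x) := by group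
      rw [e3]
      refine (escapeNorm_sub_le hinv hmul _ _).trans ?_
      have := escapeNorm_conj_le h0 h1 hinv hmul hc₀ hesc (g := a⁻¹) (h := y⁻¹)
        (by rw [hinv]; linarith) (by rw [hinv]; linarith)
      rwa [hinv a] at this
    rw [e0, abs_mul]
    calc _ ≤ N b / c * (8 * N a / c) :=
          mul_le_mul e1 e2 (abs_nonneg _) (div_nonneg (h0 _) hc.le)
      _ = _ := by field_simp
  set ε := 2 * (B.card * (8 * N g * N h / c ^ 2)) with hε
  have hk : ∀ z, |φ (⁅g, h⁆ * z) - φ z| ≤ ε := by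
    intro z
    have e1 := hsecond g⁻¹ h⁻¹ (g⁻¹ * h⁻¹ * z) (by rwa [hinv]) (by rwa [hinv])
    have e2 := hsecond h⁻¹ g⁻¹ (g⁻¹ * h⁻¹ * z) (by rwa [hinv]) (by rwa [hinv])
    simp only [hinv, inv_inv] at e1 e2
    have e3 : h * (g * (g⁻¹ * h⁻¹ * z)) = z := by group
    have e4 : g * (h * (g⁻¹ * h⁻¹ * z)) = ⁅g, h⁆ * z := by simp [commutatorElement_def, mul_assoc]
    rw [e3] at e1
    rw [e4] at e2
    rw [mul_right_comm 8 (N h)] at e2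
    rw [abs_le] at e1 e2 ⊢
    constructor <;> linarith [e1.1, e1.2, e2.1, e2.2]
  have hφ1 : ({g | N g ≤ c / 2}.ncard : ℝ) / 4 ≤ φ 1 := by
    have hsub : {g | N g ≤ c / 2} ⊆ {g | N g ≤ 2 * c} := fun x hx => by
      have : N x ≤ c / 2 := hx
      change N x ≤ 2 * c
      linarith
    have hfin' := hfin.subset hsub
    rw [Set.ncard_eq_toFinset_card _ hfin', div_eq_mul_one_div, ← nsmul_eq_mul]
    refine (Finset.card_nsmul_le_sum _ (fun y => ψ y * ψ (y⁻¹ * 1)) _ fun y hy => ?_).trans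
      (Finset.sum_le_sum_of_subset_of_nonneg (Set.Finite.toFinset_subset_toFinset.2 hsub)
        fun y _ _ => mul_nonneg (ψ0 _) (ψ0 _))
    have hy' : N y ≤ c / 2 := by simpa using hy
    have e1 : (1 : ℝ) / 2 ≤ ψ y := by
      refine le_max_of_le_right ?_
      have : N y / c ≤ 1 / 2 := by rw [div_le_iff₀ hc]; linarith
      linarith
    have e2 : ψ (y⁻¹ * 1) = ψ y := by simp [hψ, hinv]
    rw [e2]
    nlinarith
  have hφ1pos : 0 < φ 1 := by
    refine lt_of_lt_of_le ?_ hφ1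
    have : ({g | N g ≤ c / 2}).ncard ≠ 0 := by
      refine ne_of_gt ((Set.ncard_pos (hfin.subset ?_)).2 ?_)
      · intro x hx
        have : N x ≤ c / 2 := hx
        change N x ≤ 2 * c
        linarith
      · exact ⟨1, by simp only [Set.mem_ofPred_eq, h1]; positivity⟩
    have : 0 < ({g | N g ≤ c / 2}).ncard := Nat.pos_of_ne_zero this
    positivity
  have hεle : ε ≤ 64 * C * φ 1 * (N g * N h) / c ^ 2 := by
    rw [Set.ncard_eq_toFinset_card _ hfin] at hcard
    have : (B.card : ℝ) ≤ 4 * C * φ 1 := by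
      have := mul_le_mul_of_nonneg_left hφ1 hC
      linarith
    calc ε = B.card * (16 * (N g * N h) / c ^ 2) := by rw [hε]; ring
      _ ≤ (4 * C * φ 1) * (16 * (N g * N h) / c ^ 2) := by
        gcongr
        have := h0 g; have := h0 h; positivity
      _ = _ := by ring
  have hφsupp : ∀ x, φ x ≠ 0 → N x < 2 * c := by
    intro x hx
    obtain ⟨y, _, hy⟩ := Finset.exists_ne_zero_of_sum_ne_zero hx
    have e1 := ψne _ (left_ne_zero_of_mul hy)
    have e2 := ψne _ (right_ne_zero_of_mul hy)
    have e3 := hmul y (y⁻¹ * x)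
    rw [mul_inv_cancel_left] at e3
    linarith
  set k := ⁅g, h⁆ with hkdef
  have hkpow : ∀ n : ℕ, |φ (k ^ n) - φ 1| ≤ n * ε := by
    intro n
    induction n with
    | zero => simp
    | succ n ih =>
      have e1 := hk (k ^ n)
      rw [← pow_succ'] at e1
      push_cast
      calc _ = |(φ (k ^ (n + 1)) - φ (k ^ n)) + (φ (k ^ n) - φ 1)| := by ring_nf
        _ ≤ _ := (abs_add_le _ _).trans (by linarith)
  have hk4 : N k ≤ 4 * c := by
    rw [hkdef, commutatorElement_def]
    have e1 := hmul (g * h * g⁻¹) h⁻¹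
    have e2 := hmul (g * h) g⁻¹
    have e3 := hmul g h
    rw [hinv] at e1 e2
    linarith
  have hRHS : 0 ≤ 512 * C / c * N g * N h := by
    have := h0 g; have := h0 h; positivity
  rcases (h0 k).eq_or_lt with hk0 | hk0
  · rw [← hk0]; exact hRHS
  have hex : ∃ n : ℕ, 2 * c ≤ N (k ^ n) := by
    by_contra! hcon
    obtain ⟨n, hn⟩ := exists_nat_gt (4 * c / N k)
    rw [div_lt_iff₀ hk0] at hn
    have := hesc k n fun i _ => (hcon i).le.trans (by linarith)
    linarith [hcon n]
  have hn1 := Nat.find_spec hex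
  have hn2 := fun i => Nat.find_min hex (m := i)
  set n := Nat.find hex
  have hnpos : n ≠ 0 := by
    intro h
    rw [h, pow_zero, h1] at hn1
    linarith
  obtain ⟨m, hm⟩ := Nat.exists_eq_succ_of_ne_zero hnpos
  have hm1 := hesc k m fun i hi => (not_le.1 (hn2 i (by omega))).le.trans (by linarith)
  have hm2 := not_le.1 (hn2 m (by omega))
  have hnk : n * N k ≤ 8 * c := by rw [hm]; push_cast; linarith
  have hz : φ (k ^ n) = 0 := by
    by_contra hcon
    linarith [hφsupp _ hcon]
  have e1 := hkpow n
  rw [hz, zero_sub, abs_neg, abs_of_pos hφ1pos] at e1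
  have e2 : φ 1 * N k ≤ φ 1 * (512 * C / c * N g * N h) := by
    calc φ 1 * N k ≤ n * ε * N k := mul_le_mul_of_nonneg_right e1 hk0.le
      _ = (n * N k) * ε := by ring
      _ ≤ (8 * c) * (64 * C * φ 1 * (N g * N h) / c ^ 2) := by
        refine mul_le_mul hnk hεle ?_ (by positivity)
        have := h0 g; have := h0 h; positivity
      _ = _ := by field_simp; ring
  exact le_of_mul_le_mul_left e2 hφ1pos

theorem isVirtuallyNilpotent_of_escapeNorm (h0 : ∀ g, 0 ≤ N g) (h1 : N 1 = 0)
    (hinv : ∀ g, N g⁻¹ = N g)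
    (hmul : ∀ g h, N (g * h) ≤ N g + N h) (hc₀ : 0 < c₀)
    (hesc : ∀ g (n : ℕ), (∀ i ≤ n, N (g ^ i) ≤ c₀) → n / 2 * N g ≤ N (g ^ n))
    (hc : 0 < c) (hcc : c ≤ c₀ / 16) (hfin : {g | N g ≤ 2 * c}.Finite) (hC : 1 ≤ C)
    (hcard : ({g | N g ≤ 2 * c}.ncard : ℝ) ≤ C * {g | N g ≤ c / 2}.ncard) :
    IsVirtuallyNilpotent (Subgroup.closure {g | N g ≤ c / (1024 * C)}) := by
  have hle : c / (1024 * C) ≤ c := div_le_self hc.le (by linarith)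
  refine isVirtuallyNilpotent_closure_of_commutator_le N h0 h1 hinv hmul (by positivity)
    (hfin.subset fun x hx => ?_) fun g h hg hh => ?_
  · have : N x ≤ c / (1024 * C) := hx
    change N x ≤ 2 * c
    linarith
  · refine (escapeNorm_commutator_le h0 h1 hinv hmul hc₀ hesc hc hcc hfin (by linarith) hcard
      (hg.trans hle) (hh.trans hle)).trans ?_
    have hpos : 0 ≤ 512 * C / c * N g := by
      have := h0 g; positivity
    calc 512 * C / c * N g * N h ≤ 512 * C / c * N g * (c / (1024 * C)) :=
          mul_le_mul_of_nonneg_left hh hpos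
      _ = N g / 2 := by field_simp; ring

end EscapeNorm

theorem isVirtuallyNilpotent_of_relIndex_ne_zero {G : Type*} [Group G] {H L : Subgroup G}
    (hH : IsVirtuallyNilpotent H) (h : H.relIndex L ≠ 0) : IsVirtuallyNilpotent L := by
  obtain ⟨P, hP, hPn⟩ := hH
  have h1 : (P.map H.subtype).relIndex H ≠ 0 := by
    rw [Subgroup.relIndex, Subgroup.subgroupOf,
      Subgroup.comap_map_eq_self_of_injective H.subtype_injective]
    exact hP.index_ne_zero
  refine ⟨(P.map H.subtype).subgroupOf L,
    ⟨Subgroup.relIndex_ne_zero_trans h1 h⟩, ?_⟩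
  have hn : Group.IsNilpotent (P.map H.subtype) :=
    Group.nilpotent_of_mulEquiv (P.equivMapOfInjective _ H.subtype_injective)
  let f : (P.map H.subtype).subgroupOf L →* P.map H.subtype :=
    { toFun := fun x => ⟨((x : L) : G), Subgroup.mem_subgroupOf.1 x.2⟩
      map_one' := rfl
      map_mul' := fun _ _ => rfl }
  refine Subgroup.isNilpotent_of_ker_le_center f ?_
  have : f.ker = ⊥ := (MonoidHom.ker_eq_bot_iff f).2 fun x y hxy =>
    Subtype.ext (Subtype.ext (Subtype.mk.inj hxy))
  rw [this]
  exact bot_le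

theorem isVirtuallyNilpotent_closure_of_pow_subset {G : Type*} [Group G] {S A : Set G}
    {H : Subgroup G} (hH : IsVirtuallyNilpotent H) {F : Finset G} {n : ℕ}
    (hAF : A ⊆ (F : Set G) * H) (h1 : (1 : G) ∈ S) (hinv : ∀ s ∈ S, s⁻¹ ∈ S)
    (hS : S ^ n ⊆ A) (hn : F.card < n) :
    IsVirtuallyNilpotent (Subgroup.closure S) := by
  classical
  let T : ℕ → Set (G ⧸ H) := fun i => QuotientGroup.mk '' (S ^ i)
  have hT : ∀ i ≤ n, T i ⊆ F.image (QuotientGroup.mk : G → G ⧸ H) := by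
    rintro i hi _ ⟨x, hx, rfl⟩
    obtain ⟨a, ha, b, hb, rfl⟩ := hAF (hS (Set.pow_subset_pow_right h1 hi hx))
    simp only [Finset.coe_image]
    refine ⟨a, ha, ?_⟩
    rw [QuotientGroup.eq]
    simpa using hb
  have hfin : ∀ i ≤ n, (T i).Finite := fun i hi => (Finset.finite_toSet _).subset (hT i hi)
  have hmono : ∀ i, T i ⊆ T (i + 1) := fun i =>
    Set.image_mono (Set.pow_subset_pow_right h1 (Nat.le_succ i))
  obtain ⟨i, hi, hst⟩ : ∃ i < n, T (i + 1) = T i := by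
    by_contra! hcon
    have key : ∀ i ≤ n, i ≤ (T i).ncard := by
      intro i
      induction i with
      | zero => simp
      | succ i ih =>
        intro hi
        have h2 : (T i).ncard < (T (i + 1)).ncard :=
          Set.ncard_lt_ncard ((hmono i).ssubset_of_ne (hcon i (by omega)).symm) (hfin _ hi)
        have := ih (by omega)
        omega
    have h3 := key n le_rfl
    have h4 := Set.ncard_le_ncard (hT n le_rfl) (Finset.finite_toSet _)
    rw [Set.ncard_coe_finset] at h4
    have h5 := Finset.card_image_le (s := F) (f := (QuotientGroup.mk : G → G ⧸ H))
    omega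
  have hsT : ∀ s ∈ S, ∀ t ∈ T i, s • t ∈ T i := by
    rintro s hs _ ⟨x, hx, rfl⟩
    rw [← hst]
    refine ⟨s * x, ?_, rfl⟩
    rw [pow_succ']
    exact Set.mul_mem_mul hs hx
  have hcl : ∀ g ∈ Subgroup.closure S, ∀ t ∈ T i, g • t ∈ T i := by
    intro g hg
    induction hg using Subgroup.closure_induction'' with
    | mem x hx => exact hsT x hx
    | inv_mem x hx => exact hsT _ (hinv x hx)
    | one => intro t ht; simpa
    | mul x y _ _ hx hy => intro t ht; rw [mul_smul]; exact hx _ (hy _ ht)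
  refine isVirtuallyNilpotent_of_relIndex_ne_zero hH ?_
  have hstab : H.subgroupOf (Subgroup.closure S) =
      MulAction.stabilizer (Subgroup.closure S) ((1 : G) : G ⧸ H) := by
    ext x
    rw [Subgroup.mem_subgroupOf, MulAction.mem_stabilizer_iff]
    change _ ↔ (((x : G) * 1 : G) : G ⧸ H) = _
    rw [mul_one, eq_comm, QuotientGroup.eq]
    simp
  rw [Subgroup.relIndex, hstab, MulAction.index_stabilizer]
  have hof : (MulAction.orbit (Subgroup.closure S) ((1 : G) : G ⧸ H)).Finite := by
    refine (hfin i hi.le).subset ?_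
    rintro _ ⟨g, rfl⟩
    exact hcl _ g.2 _ ⟨1, Set.one_mem_pow h1, rfl⟩
  exact ((Set.ncard_pos hof).2 (MulAction.nonempty_orbit _)).ne.symm

/-- The cosets of a virtually nilpotent subgroup needed to cover a finite symmetric set are
controlled by its doubling. -/
def DoublingControl.{u} : Prop :=
  ∀ K : ℕ, ∃ C : ℕ, ∀ (G : Type u) [Group G] [DecidableEq G] (A : Finset G), 1 ∈ A →
    (∀ a ∈ A, a⁻¹ ∈ A) → (∃ X : Finset G, X.card ≤ K ∧ A * A ⊆ X * A) →
    ∃ H : Subgroup G, IsVirtuallyNilpotent H ∧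
      ∃ F : Finset G, F.card ≤ C ∧ (A : Set G) ⊆ (F : Set G) * H

theorem generalized_margulis_of_control.{u} (hctrl : DoublingControl.{u}) :
    ∀ K : ℝ, 1 ≤ K → ∃ ε₀ : ℝ, 0 < ε₀ ∧
      ∀ (X : Type u) [MetricSpace X],
        (∀ x : X, ∃ T : Finset X, (T.card : ℝ) ≤ K ∧
            Metric.ball x 4 ⊆ ⋃ y ∈ T, Metric.ball y 1) →
        ∀ Γ : Subgroup (X ≃ᵢ X),
          (∀ x : X, {γ : X ≃ᵢ X | γ ∈ Γ ∧ dist (γ x) x < 2}.Finite) →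
          ∀ (x : X) (ε : ℝ), 0 < ε → ε < ε₀ →
            IsVirtuallyNilpotent
              (Subgroup.closure {γ : X ≃ᵢ X | γ ∈ Γ ∧ dist (γ x) x < ε}) := by
  classical
  intro K hK
  obtain ⟨C, hC⟩ := hctrl ⌊K⌋₊
  refine ⟨2 / (C + 1), by positivity, ?_⟩
  intro X _ hcov Γ hfin x ε hε hε'
  have dinv : ∀ g : X ≃ᵢ X, dist (g⁻¹ x) x = dist (g x) x := by
    intro g
    have h := g.isometry.dist_eq (g⁻¹ x) x
    rw [IsometryEquiv.apply_inv_self] at h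
    rw [← h, dist_comm]
  have dmul : ∀ g h : X ≃ᵢ X, dist ((g * h) x) x ≤ dist (g x) x + dist (h x) x := by
    intro g h
    have h1 := dist_triangle (g (h x)) (g x) x
    rw [g.isometry.dist_eq] at h1
    rw [IsometryEquiv.mul_apply]
    linarith
  set A := (hfin x).toFinset with hA
  have memA : ∀ g, g ∈ A ↔ g ∈ Γ ∧ dist (g x) x < 2 := by simp [hA]
  obtain ⟨H, hH, F, hF, hAF⟩ := hC (X ≃ᵢ X) A ((memA 1).2 ⟨Γ.one_mem, by simp⟩)
    (fun a ha => (memA _).2 ⟨Γ.inv_mem ((memA a).1 ha).1, by rw [dinv]; exact ((memA a).1 ha).2⟩)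
    (by
      obtain ⟨T, hTK, hT⟩ := hcov x
      have hch : ∀ y : X, ∃ g : X ≃ᵢ X,
          (∃ g', g' ∈ Γ ∧ dist (g' x) y < 1) → g ∈ Γ ∧ dist (g x) y < 1 := by
        intro y
        by_cases h : ∃ g' : X ≃ᵢ X, g' ∈ Γ ∧ dist (g' x) y < 1
        · exact ⟨h.choose, fun _ => h.choose_spec⟩
        · exact ⟨1, fun h' => absurd h' h⟩
      choose p hp using hch
      refine ⟨T.image p, (Finset.card_image_le).trans (Nat.le_floor hTK), ?_⟩
      intro g hg
      obtain ⟨a, ha, b, hb, rfl⟩ := Finset.mem_mul.1 hg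
      rw [memA] at ha hb
      have hab : (a * b) x ∈ Metric.ball x 4 := by
        rw [Metric.mem_ball]; linarith [dmul a b]
      obtain ⟨y, hyT, hy⟩ := Set.mem_iUnion₂.1 (hT hab)
      have hpy := hp y ⟨a * b, Γ.mul_mem ha.1 hb.1, hy⟩
      refine Finset.mem_mul.2 ⟨p y, Finset.mem_image_of_mem _ hyT, (p y)⁻¹ * (a * b),
        (memA _).2 ⟨Γ.mul_mem (Γ.inv_mem hpy.1) (Γ.mul_mem ha.1 hb.1), ?_⟩, by simp⟩
      have h := (p y).isometry.dist_eq (((p y)⁻¹ * (a * b)) x) x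
      rw [IsometryEquiv.mul_apply, IsometryEquiv.apply_inv_self] at h
      rw [IsometryEquiv.mul_apply, ← h]
      have h1 := dist_triangle_right ((a * b) x) (p y x) y
      have h2 : dist ((a * b) x) y < 1 := hy
      linarith [hpy.2])
  refine isVirtuallyNilpotent_closure_of_pow_subset hH hAF ⟨Γ.one_mem, by simpa using hε⟩
    (fun s hs => ⟨Γ.inv_mem hs.1, by rw [dinv]; exact hs.2⟩) (n := C + 1) ?_ (by omega)
  have key : ∀ n : ℕ, ∀ g ∈ {γ : X ≃ᵢ X | γ ∈ Γ ∧ dist (γ x) x < ε} ^ n,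
      g ∈ Γ ∧ dist (g x) x ≤ n * ε := by
    intro n
    induction n with
    | zero =>
      intro g hg
      simp only [pow_zero, Set.mem_one] at hg
      subst hg
      exact ⟨Γ.one_mem, by simp⟩
    | succ n ih =>
      intro g hg
      rw [pow_succ] at hg
      obtain ⟨a, ha, b, hb, rfl⟩ := hg
      have := ih a ha
      refine ⟨Γ.mul_mem this.1 hb.1, ?_⟩
      push_cast
      have hb2 : dist (b x) x < ε := hb.2
      change dist ((a * b) x) x ≤ _
      linarith [dmul a b, this.2]
  intro g hg
  have h := key _ g hg
  refine Finset.mem_coe.2 ((memA g).2 ⟨h.1, h.2.trans_lt ?_⟩)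
  rw [lt_div_iff₀ (by positivity)] at hε'
  push_cast
  linarith

noncomputable section

namespace FinsuppHilbert

section FinsuppInner

variable {G : Type*}

/-- The `ℓ²` inner product on finitely supported real functions. -/
abbrev innerCore (G : Type*) : InnerProductSpace.Core ℝ (G →₀ ℝ) where
  inner f g := f.sum fun x a => a * g x
  conj_inner_symm f g := by
    classical
    simp only [conj_trivial]
    rw [Finsupp.sum_of_support_subset f (Finset.subset_union_left (s₂ := g.support)) _ (by simp),
      Finsupp.sum_of_support_subset g (Finset.subset_union_right (s₁ := f.support)) _ (by simp)]
    exact Finset.sum_congr rfl fun x _ => mul_comm _ _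
  re_inner_nonneg f := by
    simpa [Finsupp.sum] using Finset.sum_nonneg fun x _ => mul_self_nonneg (f x)
  add_left f g h := by
    classical
    exact Finsupp.sum_add_index' (by simp) (by intros; ring)
  smul_left f g r := by
    simp only [conj_trivial]
    rw [Finsupp.sum_smul_index (by simp), Finsupp.mul_sum]
    simp only [mul_assoc]
  definite f h := by
    ext x
    by_contra hx
    have hx' : f x ≠ 0 := hx
    have h2 := (Finset.sum_eq_zero_iff_of_nonneg (fun y _ => mul_self_nonneg (f y))).1 h x
      (by simpa using hx')
    exact hx' (mul_self_eq_zero.1 h2)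

instance : NormedAddCommGroup (G →₀ ℝ) := (innerCore G).toNormedAddCommGroup

instance : InnerProductSpace ℝ (G →₀ ℝ) := InnerProductSpace.ofCore (innerCore G).toCore

theorem inner_def (f g : G →₀ ℝ) : inner ℝ f g = f.sum fun x a => a * g x := rfl

theorem inner_eq_sum {f g : G →₀ ℝ} {s : Finset G} (hs : f.support ⊆ s) :
    inner ℝ f g = ∑ x ∈ s, f x * g x := by
  rw [inner_def, Finsupp.sum_of_support_subset f hs _ (by simp)]

theorem norm_sq_eq_sum {f : G →₀ ℝ} {s : Finset G} (hs : f.support ⊆ s) :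
    ‖f‖ ^ 2 = ∑ x ∈ s, f x ^ 2 := by
  rw [← real_inner_self_eq_norm_sq, inner_eq_sum hs]
  simp only [sq]

theorem inner_single (x : G) (f : G →₀ ℝ) : inner ℝ (Finsupp.single x (1 : ℝ)) f = f x := by
  simp [inner_def]

theorem norm_le_of_abs_le {f g : G →₀ ℝ} {c : ℝ} (hc : 0 ≤ c) (h : ∀ x, |f x| ≤ c * |g x|) :
    ‖f‖ ≤ c * ‖g‖ := by
  classical
  refine abs_le_of_sq_le_sq' ?_ (by positivity) |>.2
  rw [mul_pow, norm_sq_eq_sum (Finset.subset_union_left (s₂ := g.support)),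
    norm_sq_eq_sum (Finset.subset_union_right (s₁ := f.support)), Finset.mul_sum]
  refine Finset.sum_le_sum fun x _ => ?_
  have := pow_le_pow_left₀ (abs_nonneg _) (h x) 2
  rwa [mul_pow, sq_abs, sq_abs] at this

/-- Relabelling of coordinates by a permutation. -/
def perm (e : G ≃ G) : (G →₀ ℝ) →ₗ[ℝ] (G →₀ ℝ) := (Finsupp.domLCongr e).toLinearMap

theorem perm_apply (e : G ≃ G) (f : G →₀ ℝ) (x : G) : perm e f x = f (e.symm x) := by
  simp [perm, Finsupp.domLCongr_apply]

theorem inner_perm (e : G ≃ G) (f g : G →₀ ℝ) :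
    inner ℝ (perm e f) (perm e g) = inner ℝ f g := by
  classical
  have hs : (perm e f).support ⊆ f.support.map e.toEmbedding := by
    intro x hx
    rw [Finsupp.mem_support_iff, perm_apply] at hx
    exact Finset.mem_map.2 ⟨e.symm x, by simpa using hx, by simp⟩
  rw [inner_eq_sum hs, inner_eq_sum subset_rfl, Finset.sum_map]
  simp [perm_apply]

theorem norm_perm (e : G ≃ G) (f : G →₀ ℝ) : ‖perm e f‖ = ‖f‖ := by
  have h := inner_perm e f f
  rw [real_inner_self_eq_norm_sq, real_inner_self_eq_norm_sq] at h
  exact (pow_left_inj₀ (norm_nonneg _) (norm_nonneg _) two_ne_zero).1 h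

/-- Multiplication by a function. -/
def mulOp (χ : G → ℝ) : (G →₀ ℝ) →ₗ[ℝ] (G →₀ ℝ) where
  toFun f := Finsupp.onFinset f.support (fun x => χ x * f x) (by
    intro x hx
    simp only [Finsupp.mem_support_iff]
    exact right_ne_zero_of_mul hx)
  map_add' f g := by ext x; simp [mul_add]
  map_smul' c f := by ext x; simp; ring

theorem mulOp_apply (χ : G → ℝ) (f : G →₀ ℝ) (x : G) : mulOp χ f x = χ x * f x := by
  simp [mulOp]

theorem inner_mulOp (χ : G → ℝ) (f g : G →₀ ℝ) :
    inner ℝ (mulOp χ f) g = inner ℝ f (mulOp χ g) := by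
  rw [inner_eq_sum (s := f.support), inner_eq_sum subset_rfl]
  · refine Finset.sum_congr rfl fun x _ => ?_
    rw [mulOp_apply, mulOp_apply]; ring
  · intro x hx
    rw [Finsupp.mem_support_iff, mulOp_apply] at hx
    simpa using right_ne_zero_of_mul hx

theorem norm_mulOp_le {χ : G → ℝ} {c : ℝ} (hc : 0 ≤ c) (h : ∀ x, |χ x| ≤ c) (f : G →₀ ℝ) :
    ‖mulOp χ f‖ ≤ c * ‖f‖ := by
  refine norm_le_of_abs_le hc fun x => ?_
  rw [mulOp_apply, abs_mul]
  exact mul_le_mul_of_nonneg_right (h x) (abs_nonneg _)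

/-- The finitely supported function equal to `f` on `s` and zero elsewhere. -/
def restrict (s : Finset G) (f : G → ℝ) : G →₀ ℝ :=
  Finsupp.onFinset s (by classical exact fun x => if x ∈ s then f x else 0) (by
    intro x hx; by_contra h; simp [h] at hx)

theorem restrict_apply_of_mem {s : Finset G} {f : G → ℝ} {x : G} (h : x ∈ s) :
    restrict s f x = f x := by simp [restrict, h]

theorem restrict_apply_of_notMem {s : Finset G} {f : G → ℝ} {x : G} (h : x ∉ s) :
    restrict s f x = 0 := by simp [restrict, h]

theorem support_restrict_subset (s : Finset G) (f : G → ℝ) : (restrict s f).support ⊆ s :=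
  Finsupp.support_onFinset_subset

theorem norm_indicator (s : Finset G) : ‖restrict s (fun _ => (1 : ℝ))‖ ^ 2 = s.card := by
  rw [norm_sq_eq_sum (support_restrict_subset s _),
    Finset.sum_congr rfl fun x hx => by rw [restrict_apply_of_mem hx]]
  simp

theorem norm_sub_sq_of_disjoint {f g : G →₀ ℝ} (h : Disjoint f.support g.support) :
    ‖f - g‖ ^ 2 = ‖f‖ ^ 2 + ‖g‖ ^ 2 := by
  have : inner ℝ f g = 0 := by
    rw [inner_eq_sum subset_rfl]
    refine Finset.sum_eq_zero fun x hx => ?_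
    have := Finset.disjoint_left.1 h hx
    simp only [Finsupp.mem_support_iff, not_not] at this
    simp [this]
  rw [norm_sub_sq_real, this]; ring

section Group

variable [Group G]

/-- Left translation `u ↦ u (g⁻¹ ·)`. -/
def tau (g : G) : (G →₀ ℝ) →ₗ[ℝ] (G →₀ ℝ) := perm (Equiv.mulLeft g)

/-- Right translation `u ↦ u (· g)`. -/
def rho (g : G) : (G →₀ ℝ) →ₗ[ℝ] (G →₀ ℝ) := perm (Equiv.mulRight g⁻¹)

theorem tau_apply (g : G) (f : G →₀ ℝ) (x : G) : tau g f x = f (g⁻¹ * x) := by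
  simp [tau, perm_apply]

theorem rho_apply (g : G) (f : G →₀ ℝ) (x : G) : rho g f x = f (x * g) := by
  simp [rho, perm_apply]

theorem norm_tau (g : G) (f : G →₀ ℝ) : ‖tau g f‖ = ‖f‖ := norm_perm _ _

theorem norm_rho (g : G) (f : G →₀ ℝ) : ‖rho g f‖ = ‖f‖ := norm_perm _ _

theorem tau_one (f : G →₀ ℝ) : tau 1 f = f := by ext x; simp [tau_apply]

theorem tau_mul (g h : G) (f : G →₀ ℝ) : tau (g * h) f = tau g (tau h f) := by
  ext x; simp [tau_apply, mul_assoc]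

theorem tau_rho (g h : G) (f : G →₀ ℝ) : tau g (rho h f) = rho h (tau g f) := by
  ext x; simp [tau_apply, rho_apply, mul_assoc]

theorem inner_rho (g : G) (f h : G →₀ ℝ) : inner ℝ (rho g f) h = inner ℝ f (rho g⁻¹ h) := by
  have : rho g (rho g⁻¹ h) = h := by ext x; simp [rho_apply]
  conv_lhs => rw [← this]
  exact inner_perm _ _ _

/-- Averaging over right translations by the elements of `U`. -/
def avg (U : Finset G) : (G →₀ ℝ) →ₗ[ℝ] (G →₀ ℝ) := (U.card : ℝ)⁻¹ • ∑ u ∈ U, rho u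

theorem avg_apply (U : Finset G) (f : G →₀ ℝ) :
    avg U f = (U.card : ℝ)⁻¹ • ∑ u ∈ U, rho u f := by
  simp [avg]

theorem avg_apply_apply (U : Finset G) (f : G →₀ ℝ) (x : G) :
    avg U f x = (U.card : ℝ)⁻¹ * ∑ u ∈ U, f (x * u) := by
  simp [avg_apply, rho_apply]

theorem norm_avg_le (U : Finset G) (f : G →₀ ℝ) : ‖avg U f‖ ≤ ‖f‖ := by
  rcases U.eq_empty_or_nonempty with rfl | hU
  · simp [avg_apply]
  have hc : (0 : ℝ) < U.card := by exact_mod_cast hU.card_pos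
  rw [avg_apply, norm_smul, norm_inv, Real.norm_natCast, inv_mul_le_iff₀ hc]
  calc ‖∑ u ∈ U, rho u f‖ ≤ ∑ u ∈ U, ‖rho u f‖ := norm_sum_le _ _
    _ = U.card * ‖f‖ := by simp [norm_rho]

theorem tau_avg (g : G) (U : Finset G) (f : G →₀ ℝ) : tau g (avg U f) = avg U (tau g f) := by
  simp [avg_apply, map_sum, tau_rho]

theorem inner_avg {U : Finset G} (hU : ∀ u ∈ U, u⁻¹ ∈ U) (f h : G →₀ ℝ) :
    inner ℝ (avg U f) h = inner ℝ f (avg U h) := by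
  rw [avg_apply, avg_apply, real_inner_smul_left, real_inner_smul_right, sum_inner, inner_sum]
  congr 1
  refine Finset.sum_bij (fun u _ => u⁻¹) hU (fun a _ b _ h => inv_injective h)
    (fun b hb => ⟨b⁻¹, hU b hb, by simp⟩) fun u _ => inner_rho u f h

theorem avg_mono {U : Finset G} {f : G →₀ ℝ} (h : ∀ x, 0 ≤ f x) (x : G) : 0 ≤ avg U f x := by
  rw [avg_apply_apply]
  exact mul_nonneg (by positivity) (Finset.sum_nonneg fun _ _ => h _)

theorem support_avg_subset [DecidableEq G] {U Ω : Finset G} (hU : ∀ u ∈ U, u⁻¹ ∈ U)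
    {f : G →₀ ℝ} (hf : f.support ⊆ Ω) : (avg U f).support ⊆ Ω * U := by
  intro x hx
  rw [Finsupp.mem_support_iff, avg_apply_apply] at hx
  obtain ⟨u, hu, hne⟩ := Finset.exists_ne_zero_of_sum_ne_zero (right_ne_zero_of_mul hx)
  exact Finset.mem_mul.2 ⟨x * u, hf (by simpa using hne), u⁻¹, hU u hu, by simp⟩

theorem support_tau_subset [DecidableEq G] (g : G) {Ω : Finset G}
    {f : G →₀ ℝ} (hf : f.support ⊆ Ω) : (tau g f).support ⊆ g • Ω := by
  intro x hx
  rw [Finsupp.mem_support_iff, tau_apply] at hx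
  exact Finset.mem_smul_finset.2 ⟨g⁻¹ * x, hf (by simpa using hx), by simp⟩

theorem support_mulOp_subset {G : Type*} {χ : G → ℝ} {Ω : Finset G} (hχ : ∀ x, χ x ≠ 0 → x ∈ Ω)
    (f : G →₀ ℝ) : (mulOp χ f).support ⊆ Ω := by
  intro x hx
  rw [Finsupp.mem_support_iff, mulOp_apply] at hx
  exact hχ x (left_ne_zero_of_mul hx)

theorem norm_avg_single_sq (U : Finset G) (hU : U.Nonempty) (x : G) :
    ‖avg U (Finsupp.single x 1)‖ ^ 2 = (U.card : ℝ)⁻¹ := by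
  classical
  have hs : avg U (Finsupp.single x (1 : ℝ)) =
      (U.card : ℝ)⁻¹ • restrict (U.image fun u => x * u⁻¹) (fun _ => (1 : ℝ)) := by
    ext y
    rw [avg_apply_apply, Finsupp.smul_apply, smul_eq_mul]
    congr 1
    have h1 : ∀ u : G, (Finsupp.single x (1 : ℝ)) (y * u) = if u = y⁻¹ * x then 1 else 0 := by
      intro u
      rw [Finsupp.single_apply]
      congr 1
      rw [eq_inv_mul_iff_mul_eq, @eq_comm _ x]
    simp only [h1, Finset.sum_ite_eq']
    by_cases h : y⁻¹ * x ∈ U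
    · rw [if_pos h, restrict_apply_of_mem]
      exact Finset.mem_image.2 ⟨_, h, by simp⟩
    · rw [if_neg h, restrict_apply_of_notMem]
      intro h'
      obtain ⟨u, hu, rfl⟩ := Finset.mem_image.1 h'
      simp [hu] at h
  rw [hs, norm_smul, mul_pow, norm_indicator, Finset.card_image_of_injective]
  · have hc : (0 : ℝ) < U.card := by exact_mod_cast hU.card_pos
    rw [norm_inv, Real.norm_natCast]; field_simp
  · intro a b h
    simpa using h

end Group

end FinsuppInner

section Trace

variable {G : Type*}

theorem exists_threshold_gap {ι : Type*} (s : Finset ι) (l : ι → ℝ) {D : ℕ} {θ : ℝ} (hθ : 0 < θ)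
    (hs : s.card ≤ D) : ∃ θ' : ℝ, θ / 2 ≤ θ' - θ / (2 * (D + 1)) ∧ θ' ≤ θ ∧
      ∀ i ∈ s, l i < θ' → l i ≤ θ' - θ / (2 * (D + 1)) := by
  classical
  set γ := θ / (2 * ((D : ℝ) + 1)) with hγ
  have hγ0 : 0 < γ := by positivity
  have hγD : γ * (D + 1) = θ / 2 := by rw [hγ]; field_simp
  by_contra! hcon
  have h1 : ∀ k ∈ Finset.range (D + 1), ∃ i ∈ s, l i < θ / 2 + (k + 1) * γ ∧
      θ / 2 + k * γ < l i := by
    intro k hk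
    have hk' : (k : ℝ) + 1 ≤ D + 1 := by
      have := Finset.mem_range.1 hk
      exact_mod_cast this
    obtain ⟨i, hi, h2, h3⟩ := hcon (θ / 2 + (k + 1) * γ)
      (by nlinarith [show (0 : ℝ) ≤ k from Nat.cast_nonneg k]) (by nlinarith)
    exact ⟨i, hi, h2, by linarith⟩
  have : Nonempty ι := ⟨(h1 0 (by simp)).choose⟩
  choose! f hf using h1
  have hinj : Set.InjOn f (Finset.range (D + 1)) := by
    intro a ha b hb hab
    have ha' := hf a ha
    have hb' := hf b hb
    rw [← hab] at hb'
    by_contra hne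
    rcases lt_or_gt_of_ne hne with h | h
    · have : (a : ℝ) + 1 ≤ b := by exact_mod_cast h
      nlinarith [ha'.2.1, hb'.2.2]
    · have : (b : ℝ) + 1 ≤ a := by exact_mod_cast h
      nlinarith [hb'.2.1, ha'.2.2]
  have := Finset.card_le_card_of_injOn f (fun k hk => (hf k hk).1) hinj
  rw [Finset.card_range] at this
  omega

/-- Spectral decomposition with a spectral gap, for positive symmetric operators of controlled
trace. -/
theorem exists_spectral_gap {T : (G →₀ ℝ) →ₗ[ℝ] (G →₀ ℝ)} (hT : T.IsSymmetric)
    (hpos : ∀ w, 0 ≤ inner ℝ w (T w)) {Ω : Finset G} (hΩ : ∀ w, (T w).support ⊆ Ω)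
    {t θ : ℝ} (hθ : 0 < θ) (htr : ∑ x ∈ Ω, T (Finsupp.single x 1) x ≤ t) {D₀ : ℕ}
    (hD : 2 * t / θ ≤ D₀) :
    ∃ (D : ℕ) (e : Fin D → (G →₀ ℝ)) (l : Fin D → ℝ) (θ' : ℝ), D ≤ D₀ ∧ Orthonormal ℝ e ∧
      (∀ i, T (e i) = l i • e i) ∧ (∀ i, θ' ≤ l i) ∧ θ / 2 ≤ θ' - θ / (2 * (D₀ + 1)) ∧ θ' ≤ θ ∧
      ∀ v, (∀ i, inner ℝ (e i) v = 0) → ‖T v‖ ≤ (θ' - θ / (2 * (D₀ + 1))) * ‖v‖ := by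
  classical
  let W : Submodule ℝ (G →₀ ℝ) := Finsupp.supported ℝ ℝ (Ω : Set G)
  have memW : ∀ w : G →₀ ℝ, w ∈ W ↔ w.support ⊆ Ω := fun w => by
    simp [W, Finsupp.mem_supported]
  have : FiniteDimensional ℝ W :=
    Module.Finite.equiv (Finsupp.supportedEquivFinsupp (M := ℝ) (R := ℝ) (Ω : Set G)).symm
  have hTW : ∀ w, T w ∈ W := fun w => (memW _).2 (hΩ w)
  let T' : W →ₗ[ℝ] W := T.restrict (p := W) (q := W) fun w _ => hTW w
  have hT' : T'.IsSymmetric := fun x y => hT x y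
  let b := hT'.eigenvectorBasis rfl
  let l := hT'.eigenvalues rfl
  have hb : ∀ i, T (b i) = l i • (b i : G →₀ ℝ) := fun i => by
    exact congrArg Subtype.val (hT'.apply_eigenvectorBasis rfl i)
  have hbo : Orthonormal ℝ fun i => (b i : G →₀ ℝ) :=
    b.orthonormal.comp_linearIsometry W.subtypeₗᵢ
  have hbn : ∀ i, ‖(b i : G →₀ ℝ)‖ = 1 := hbo.1
  have hlpos : ∀ i, 0 ≤ l i := fun i => by
    have := hpos (b i)
    rw [hb, real_inner_smul_right, real_inner_self_eq_norm_sq, hbn] at this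
    simpa using this
  have hexp : ∀ w, T w = ∑ i, (l i * inner ℝ (b i : G →₀ ℝ) w) • (b i : G →₀ ℝ) := by
    intro w
    have h1 := congrArg Subtype.val (b.sum_repr' ⟨T w, hTW w⟩)
    simp only [Submodule.coe_sum, Submodule.coe_smul, Submodule.coe_inner] at h1
    rw [← h1]
    refine Finset.sum_congr rfl fun i _ => ?_
    rw [← hT, hb, real_inner_smul_left]
  have htrace : ∑ i, l i ≤ t := by
    refine le_of_eq_of_le ?_ htr
    have h1 : ∀ x ∈ Ω, T (Finsupp.single x 1) x = ∑ i, l i * (b i : G →₀ ℝ) x ^ 2 := by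
      intro x _
      rw [hexp, Finsupp.finsetSum_apply]
      refine Finset.sum_congr rfl fun i _ => ?_
      rw [real_inner_comm, inner_single, Finsupp.smul_apply, smul_eq_mul]; ring
    rw [Finset.sum_congr rfl h1, Finset.sum_comm]
    refine Finset.sum_congr rfl fun i _ => ?_
    rw [← Finset.mul_sum, ← norm_sq_eq_sum ((memW _).1 (b i).2), hbn]
    ring
  set s := Finset.univ.filter fun i => θ / 2 ≤ l i with hs
  have hscard : s.card ≤ D₀ := by
    have h1 : (s.card : ℝ) * (θ / 2) ≤ t := by
      rw [← nsmul_eq_mul]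
      refine (Finset.card_nsmul_le_sum s l _ fun i hi => by simpa [hs] using hi).trans ?_
      exact (Finset.sum_le_sum_of_subset_of_nonneg (Finset.subset_univ _)
        fun i _ _ => hlpos i).trans htrace
    have h2 : (s.card : ℝ) ≤ 2 * t / θ := by
      rw [le_div_iff₀ hθ]; linarith
    exact_mod_cast h2.trans hD
  obtain ⟨θ', hθ1, hθ2, hgap⟩ := exists_threshold_gap s l hθ hscard
  have hγ : 0 < θ / (2 * ((D₀ : ℝ) + 1)) := by positivity
  set s' := Finset.univ.filter fun i => θ' ≤ l i with hs'
  have hs's : s' ⊆ s := by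
    intro i hi
    simp only [hs, hs', Finset.mem_filter, Finset.mem_univ, true_and] at hi ⊢
    linarith
  refine ⟨s'.card, fun i => b (s'.orderEmbOfFin rfl i), fun i => l (s'.orderEmbOfFin rfl i), θ',
    (Finset.card_le_card hs's).trans hscard, hbo.comp _ (s'.orderEmbOfFin rfl).injective,
    fun i => hb _, fun i => ?_, hθ1, hθ2, ?_⟩
  · exact (Finset.mem_filter.1 (s'.orderEmbOfFin_mem rfl i)).2
  · intro v hv
    have hv' : ∀ j ∈ s', inner ℝ (b j : G →₀ ℝ) v = 0 := by
      intro j hj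
      have : j ∈ Set.range (s'.orderEmbOfFin rfl) := by
        rw [Finset.range_orderEmbOfFin]; exact hj
      obtain ⟨i, rfl⟩ := this
      exact hv i
    set κ := θ' - θ / (2 * ((D₀ : ℝ) + 1)) with hκ
    have hκ0 : 0 ≤ κ := by linarith
    have hle : ∀ i, l i * |inner ℝ (b i : G →₀ ℝ) v| ≤ κ * |inner ℝ (b i : G →₀ ℝ) v| := by
      intro i
      by_cases hi : i ∈ s'
      · simp [hv' i hi]
      · refine mul_le_mul_of_nonneg_right ?_ (abs_nonneg _)
        have hi' : l i < θ' := by simpa [hs'] using hi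
        by_cases his : i ∈ s
        · exact hgap i his hi'
        · have : l i < θ / 2 := by simpa [hs] using his
          linarith
    refine abs_le_of_sq_le_sq' ?_ (by positivity) |>.2
    have h1 : ‖T v‖ ^ 2 = ∑ i, (l i * inner ℝ (b i : G →₀ ℝ) v) ^ 2 := by
      rw [hexp v, ← real_inner_self_eq_norm_sq, hbo.inner_sum]
      simp [sq]
    rw [h1, mul_pow]
    calc _ ≤ ∑ i, κ ^ 2 * ‖inner ℝ (b i : G →₀ ℝ) v‖ ^ 2 := by
          refine Finset.sum_le_sum fun i _ => ?_
          have := pow_le_pow_left₀ (mul_nonneg (hlpos i) (abs_nonneg _)) (hle i) 2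
          simpa [mul_pow] using this
      _ ≤ κ ^ 2 * ‖v‖ ^ 2 := by
          rw [← Finset.mul_sum]
          exact mul_le_mul_of_nonneg_left (hbo.sum_inner_products_le v) (sq_nonneg _)

end Trace

section Projection

variable {G : Type*}

/-- Orthogonal projection onto the span of an orthonormal family. -/
def proj {D : ℕ} (e : Fin D → (G →₀ ℝ)) (v : G →₀ ℝ) : G →₀ ℝ := ∑ i, inner ℝ (e i) v • e i

section proj

variable {D : ℕ} {e : Fin D → (G →₀ ℝ)}

theorem inner_sub_proj (he : Orthonormal ℝ e) (v : G →₀ ℝ) (i : Fin D) :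
    inner ℝ (e i) (v - proj e v) = 0 := by
  rw [inner_sub_right, proj, he.inner_right_fintype, sub_self]

theorem inner_proj_sub_proj (he : Orthonormal ℝ e) (u v : G →₀ ℝ) :
    inner ℝ (proj e u) (v - proj e v) = 0 := by
  conv_lhs => rw [proj, sum_inner]
  refine Finset.sum_eq_zero fun i _ => ?_
  rw [real_inner_smul_left, inner_sub_proj he, mul_zero]

theorem norm_proj_sq_add (he : Orthonormal ℝ e) (v : G →₀ ℝ) :
    ‖proj e v‖ ^ 2 + ‖v - proj e v‖ ^ 2 = ‖v‖ ^ 2 := by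
  have h := norm_add_sq_real (proj e v) (v - proj e v)
  rw [inner_proj_sub_proj he, add_sub_cancel] at h
  linarith

theorem norm_proj_le (he : Orthonormal ℝ e) (v : G →₀ ℝ) : ‖proj e v‖ ≤ ‖v‖ := by
  refine abs_le_of_sq_le_sq' ?_ (norm_nonneg _) |>.2
  nlinarith [norm_proj_sq_add he v]

theorem norm_sub_proj_le (he : Orthonormal ℝ e) (v : G →₀ ℝ) : ‖v - proj e v‖ ≤ ‖v‖ := by
  refine abs_le_of_sq_le_sq' ?_ (norm_nonneg _) |>.2
  nlinarith [norm_proj_sq_add he v]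

theorem abs_inner_le_norm (he : Orthonormal ℝ e) (v : G →₀ ℝ) (i : Fin D) :
    |inner ℝ (e i) v| ≤ ‖v‖ := by
  simpa [he.1 i] using abs_real_inner_le_norm (e i) v

end proj

variable [Group G]

/-- The element `h` moves `avg U (avg U w)` by at most `δ ‖w‖` for all `w` supported in `Ω`. -/
def Small (U Ω : Finset G) (δ : ℝ) (h : G) : Prop :=
  ∀ w : G →₀ ℝ, w.support ⊆ Ω → ‖tau h (avg U (avg U w)) - avg U (avg U w)‖ ≤ δ * ‖w‖

theorem norm_tau_mul_sub_le (g h : G) (w : G →₀ ℝ) :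
    ‖tau (g * h) w - w‖ ≤ ‖tau g w - w‖ + ‖tau h w - w‖ := by
  have : tau (g * h) w - w = tau g (tau h w - w) + (tau g w - w) := by
    rw [tau_mul, map_sub]; abel
  rw [this, add_comm]
  exact (norm_add_le _ _).trans_eq (by rw [norm_tau, add_comm])

theorem norm_tau_inv_sub (g : G) (w : G →₀ ℝ) : ‖tau g⁻¹ w - w‖ = ‖tau g w - w‖ := by
  rw [← norm_tau g (tau g⁻¹ w - w), map_sub, ← tau_mul, mul_inv_cancel, tau_one, norm_sub_rev]

theorem Small.mul {U Ω : Finset G} {a b : ℝ} {g h : G} (hg : Small U Ω a g)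
    (hh : Small U Ω b h) : Small U Ω (a + b) (g * h) := fun w hw =>
  (norm_tau_mul_sub_le g h _).trans (by linarith [hg w hw, hh w hw])

theorem Small.inv {U Ω : Finset G} {a : ℝ} {g : G} (hg : Small U Ω a g) :
    Small U Ω a g⁻¹ := fun w hw => by
  rw [norm_tau_inv_sub]; exact hg w hw

theorem Small.mono {U Ω : Finset G} {a b : ℝ} {g : G} (hg : Small U Ω a g) (h : a ≤ b) :
    Small U Ω b g := fun w hw =>
  (hg w hw).trans (mul_le_mul_of_nonneg_right h (norm_nonneg _))

theorem small_one {U Ω : Finset G} {a : ℝ} (ha : 0 ≤ a) : Small U Ω a 1 := fun w _ => by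
  rw [tau_one, sub_self, norm_zero]; positivity

theorem norm_compression_sub_le {δ η : ℝ} {D : ℕ}
    {e : Fin D → (G →₀ ℝ)} (he : Orthonormal ℝ e) {B : (G →₀ ℝ) →ₗ[ℝ] (G →₀ ℝ)}
    (hB : ∀ v, ‖B v‖ ≤ ‖v‖) (hBperp : ∀ v, (∀ i, inner ℝ (e i) v = 0) → ‖B v‖ ≤ δ * ‖v‖)
    (hδ : 0 ≤ δ) {g g' : G}
    (hη : ∀ i j, |inner ℝ (e i) (tau g (B (e j))) - inner ℝ (e i) (tau g' (B (e j)))| ≤ η)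
    (w : G →₀ ℝ) : ‖B (tau g (B w)) - B (tau g' (B w))‖ ≤ (4 * δ + D * (D * η)) * ‖w‖ := by
  set p := proj e w with hp
  set y := tau g (B p) - tau g' (B p) with hy
  have h1 : B (tau g (B w)) - B (tau g' (B w)) =
      B (proj e y) + B (y - proj e y) + (B (tau g (B (w - p))) - B (tau g' (B (w - p)))) := by
    simp only [hy, map_sub]; abel
  have hwp : ‖B (w - p)‖ ≤ δ * ‖w‖ :=
    (hBperp _ (inner_sub_proj he w)).trans
      (mul_le_mul_of_nonneg_left (norm_sub_proj_le he w) hδ)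
  have h2 : ‖B (tau g (B (w - p))) - B (tau g' (B (w - p)))‖ ≤ 2 * δ * ‖w‖ := by
    refine (norm_sub_le _ _).trans ?_
    have e1 := hB (tau g (B (w - p)))
    have e2 := hB (tau g' (B (w - p)))
    rw [norm_tau] at e1 e2
    linarith
  have hyn : ‖y‖ ≤ 2 * ‖w‖ := by
    refine (norm_sub_le _ _).trans ?_
    rw [norm_tau, norm_tau]
    linarith [(hB p).trans (norm_proj_le he w)]
  have h3 : ‖B (y - proj e y)‖ ≤ 2 * δ * ‖w‖ := by
    refine (hBperp _ (inner_sub_proj he y)).trans ?_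
    have := mul_le_mul_of_nonneg_left ((norm_sub_proj_le he y).trans hyn) hδ
    linarith
  have h4 : ∀ i, |inner ℝ (e i) y| ≤ D * (η * ‖w‖) := by
    intro i
    have : inner ℝ (e i) y = ∑ j, inner ℝ (e j) w *
        (inner ℝ (e i) (tau g (B (e j))) - inner ℝ (e i) (tau g' (B (e j)))) := by
      simp only [hy, hp, proj, map_sum, map_smul, inner_sub_right, inner_sum,
        real_inner_smul_right, ← Finset.sum_sub_distrib, mul_sub]
    rw [this]
    refine (Finset.abs_sum_le_sum_abs _ _).trans ?_
    refine (Finset.sum_le_card_nsmul _ _ (η * ‖w‖) fun j _ => ?_).trans_eq (by simp)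
    rw [abs_mul, mul_comm]
    exact mul_le_mul (hη i j) (abs_inner_le_norm he w j) (abs_nonneg _)
      ((abs_nonneg _).trans (hη i j))
  have h5 : ‖B (proj e y)‖ ≤ D * (D * (η * ‖w‖)) := by
    refine (hB _).trans ?_
    rw [proj]
    refine (norm_sum_le _ _).trans ?_
    refine (Finset.sum_le_card_nsmul _ _ (D * (η * ‖w‖)) fun i _ => ?_).trans_eq (by simp)
    rw [norm_smul, he.1 i, mul_one]
    exact h4 i
  rw [h1]
  refine (norm_add_le _ _).trans ?_
  have := norm_add_le (B (proj e y)) (B (y - proj e y))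
  calc _ ≤ (D * (D * (η * ‖w‖)) + 2 * δ * ‖w‖) + 2 * δ * ‖w‖ := by linarith
    _ = _ := by ring

theorem inner_avg_avg_self {U : Finset G} (hU : ∀ u ∈ U, u⁻¹ ∈ U) (w : G →₀ ℝ) :
    inner ℝ w (avg U (avg U w)) = ‖avg U w‖ ^ 2 := by
  rw [← inner_avg hU, real_inner_self_eq_norm_sq]

section localAvg

variable {U : Finset G} (χ : G → ℝ)

/-- The operator `χ Q² χ`, with `Q` the averaging operator of `U`. -/
def localAvg (U : Finset G) (χ : G → ℝ) : (G →₀ ℝ) →ₗ[ℝ] (G →₀ ℝ) :=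
  mulOp χ ∘ₗ avg U ∘ₗ avg U ∘ₗ mulOp χ

theorem localAvg_apply (w : G →₀ ℝ) :
    localAvg U χ w = mulOp χ (avg U (avg U (mulOp χ w))) := rfl

theorem inner_localAvg (hU : ∀ u ∈ U, u⁻¹ ∈ U) (w : G →₀ ℝ) :
    inner ℝ w (localAvg U χ w) = ‖avg U (mulOp χ w)‖ ^ 2 := by
  rw [localAvg_apply, ← inner_mulOp, inner_avg_avg_self hU]

theorem isSymmetric_localAvg (hU : ∀ u ∈ U, u⁻¹ ∈ U) : (localAvg U χ).IsSymmetric := fun x y => by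
  rw [localAvg_apply, localAvg_apply, inner_mulOp, inner_avg hU, inner_avg hU, inner_mulOp]

theorem trace_localAvg_le (hU : ∀ u ∈ U, u⁻¹ ∈ U) (hne : U.Nonempty) {χ : G → ℝ}
    (hχ : ∀ x, |χ x| ≤ 1) (Ω : Finset G) :
    ∑ x ∈ Ω, localAvg U χ (Finsupp.single x 1) x ≤ Ω.card / U.card := by
  rw [div_eq_mul_inv, ← nsmul_eq_mul]
  refine Finset.sum_le_card_nsmul _ _ _ fun x _ => ?_
  rw [← inner_single, inner_localAvg _ hU]
  have : mulOp χ (Finsupp.single x (1 : ℝ)) = χ x • Finsupp.single x (1 : ℝ) := by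
    classical
    ext y
    rw [mulOp_apply, Finsupp.smul_apply, smul_eq_mul, Finsupp.single_apply]
    split_ifs with h
    · rw [h]
    · simp
  rw [this, map_smul, norm_smul, mul_pow, norm_avg_single_sq U hne]
  have h1 : ‖χ x‖ ^ 2 ≤ 1 := pow_le_one₀ (norm_nonneg _) (hχ x)
  exact mul_le_of_le_one_left (by positivity) h1

end localAvg

theorem mulOp_eq_self {G : Type*} {χ : G → ℝ} {w : G →₀ ℝ} (h : ∀ x ∈ w.support, χ x = 1) :
    mulOp χ w = w := by
  ext x
  rw [mulOp_apply]
  by_cases hx : x ∈ w.support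
  · rw [h x hx, one_mul]
  · simp only [Finsupp.mem_support_iff, not_not] at hx
    rw [hx, mul_zero]

/-- Precompactness: a positive proportion of the elements of `A` act in almost the same way on
doubly averaged functions supported in `Ω`. -/
theorem exists_large_small_subset (R : ℝ) {δ : ℝ} (hδ : 0 < δ) :
    ∃ C : ℕ, 0 < C ∧ ∀ (G : Type*) [Group G] [DecidableEq G] (A Ω Ω' U : Finset G),
      U.Nonempty → (∀ u ∈ U, u⁻¹ ∈ U) → Ω ⊆ Ω' → A * (Ω * U) ⊆ Ω' →
      (Ω'.card : ℝ) ≤ R * U.card →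
      ∃ S ⊆ A, A.card ≤ C * S.card ∧ ∀ g ∈ S, ∀ h ∈ S, Small U Ω δ (g⁻¹ * h) := by
  set θ := (δ / 8) ^ 2 with hθ
  obtain ⟨D₀, hD₀⟩ := exists_nat_ge (2 * R / θ)
  set η := δ / (2 * ((D₀ : ℝ) * D₀ + 1)) with hη
  have hη0 : 0 < η := by positivity
  have hθ0 : 0 < θ := by positivity
  set L := ⌊2 / η⌋₊ + 1 with hL
  refine ⟨L ^ (D₀ * D₀), by positivity, ?_⟩
  intro G _ _ A Ω Ω' U hne hU hΩ hAΩ hR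
  have hUc : (0 : ℝ) < U.card := by exact_mod_cast hne.card_pos
  rcases A.eq_empty_or_nonempty with rfl | hA
  · exact ⟨∅, subset_rfl, by simp, by simp⟩
  set χ : G → ℝ := fun x => if x ∈ Ω' then 1 else 0 with hχ
  have hχ1 : ∀ x, |χ x| ≤ 1 := fun x => by simp only [hχ]; split_ifs <;> simp
  obtain ⟨D, e, l, θ', hD, he, -, -, -, hθ', hperp⟩ := exists_spectral_gap
    (isSymmetric_localAvg χ hU) (fun w => by rw [inner_localAvg _ hU]; positivity)
    (Ω := Ω') (fun w => support_mulOp_subset (fun x hx => by simpa [hχ] using hx) _) hθ0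
    ((trace_localAvg_le hU hne hχ1 Ω').trans ((div_le_iff₀ hUc).2 hR)) hD₀
  set B : (G →₀ ℝ) →ₗ[ℝ] (G →₀ ℝ) := avg U ∘ₗ mulOp χ with hB
  have hB1 : ∀ v, ‖B v‖ ≤ ‖v‖ := fun v => (norm_avg_le _ _).trans
    (by simpa using norm_mulOp_le zero_le_one hχ1 v)
  have hBperp : ∀ v, (∀ i, inner ℝ (e i) v = 0) → ‖B v‖ ≤ δ / 8 * ‖v‖ := by
    intro v hv
    refine abs_le_of_sq_le_sq' ?_ (by positivity) |>.2
    have h1 : ‖B v‖ ^ 2 = inner ℝ v (localAvg U χ v) := (inner_localAvg χ hU v).symm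
    have h2 := hperp v hv
    have h3 := real_inner_le_norm v (localAvg U χ v)
    have h4 : 0 < θ / (2 * ((D₀ : ℝ) + 1)) := by positivity
    have h5 : ‖localAvg U χ v‖ ≤ θ * ‖v‖ := h2.trans (by gcongr; linarith)
    rw [h1, mul_pow, ← hθ]
    nlinarith [norm_nonneg v]
  set M : G → Fin D → Fin D → ℝ := fun g i j => inner ℝ (e i) (tau g (B (e j))) with hM
  have hM1 : ∀ g i j, |M g i j| ≤ 1 := fun g i j => by
    refine (abs_inner_le_norm he _ i).trans ?_
    rw [norm_tau]
    exact (hB1 _).trans_eq (he.1 j)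
  have hfl : ∀ g i j, ⌊(M g i j + 1) / η⌋₊ < L := fun g i j => by
    rw [hL, Nat.lt_succ_iff]
    refine Nat.floor_le_floor ?_
    gcongr
    linarith [(abs_le.1 (hM1 g i j)).2]
  set f : G → Fin D → Fin D → Fin L := fun g i j => ⟨_, hfl g i j⟩ with hf
  have hcard : (Finset.univ : Finset (Fin D → Fin D → Fin L)).card ≤ L ^ (D₀ * D₀) := by
    rw [Finset.card_univ]
    simp only [Fintype.card_fun, Fintype.card_fin, ← pow_mul]
    exact Nat.pow_le_pow_right (by omega) (Nat.mul_le_mul hD hD)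
  obtain ⟨y, -, hy⟩ := Finset.exists_le_card_fiber_of_nsmul_le_card_of_maps_to (s := A)
    (t := Finset.univ) (f := f) (b := (A.card : ℝ) / (L ^ (D₀ * D₀) : ℕ))
    (fun a _ => Finset.mem_univ _) ⟨f 1, Finset.mem_univ _⟩ (by
      rw [nsmul_eq_mul]
      have hpos : (0 : ℝ) < (L ^ (D₀ * D₀) : ℕ) := by positivity
      rw [mul_div_assoc', div_le_iff₀ hpos, mul_comm]
      gcongr)
  refine ⟨A.filter fun a => f a = y, Finset.filter_subset _ _, ?_, ?_⟩
  · have hpos : (0 : ℝ) < (L ^ (D₀ * D₀) : ℕ) := by positivity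
    rw [div_le_iff₀ hpos] at hy
    rw [mul_comm]
    exact_mod_cast hy
  intro g hg h hh w hw
  rw [Finset.mem_filter] at hg hh
  have hgh : ∀ i j, |M g i j - M h i j| ≤ η := by
    intro i j
    have h1 : ⌊(M g i j + 1) / η⌋₊ = ⌊(M h i j + 1) / η⌋₊ := by
      have := congrFun (congrFun (hg.2.trans hh.2.symm) i) j
      simpa [hf] using this
    have pg : 0 ≤ (M g i j + 1) / η :=
      div_nonneg (by linarith [(abs_le.1 (hM1 g i j)).1]) hη0.le
    have ph : 0 ≤ (M h i j + 1) / η :=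
      div_nonneg (by linarith [(abs_le.1 (hM1 h i j)).1]) hη0.le
    have a1 := Nat.floor_le pg
    have a2 := Nat.lt_floor_add_one ((M g i j + 1) / η)
    have a3 := Nat.floor_le ph
    have a4 := Nat.lt_floor_add_one ((M h i j + 1) / η)
    rw [h1] at a1 a2
    have : |(M g i j + 1) / η - (M h i j + 1) / η| ≤ 1 := by
      rw [abs_le]; constructor <;> linarith
    rw [← sub_div, abs_div, abs_of_pos hη0, div_le_one hη0] at this
    simpa using this
  have hcomp : ∀ g ∈ A, B (tau g (B w)) = tau g (avg U (avg U w)) := by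
    intro g hg
    have h1 : mulOp χ w = w := mulOp_eq_self fun x hx => by simp [hχ, hΩ (hw hx)]
    have h2 : mulOp χ (tau g (avg U w)) = tau g (avg U w) := mulOp_eq_self fun x hx => by
      have h3 := support_tau_subset g (support_avg_subset hU hw) hx
      simp [hχ, hAΩ (Finset.smul_finset_subset_mul hg h3)]
    simp only [hB, LinearMap.comp_apply, h1, h2]
    exact (tau_avg g U (avg U w)).symm
  have key := norm_compression_sub_le he hB1 hBperp (by positivity) hgh w
  rw [hcomp g hg.1, hcomp h hh.1] at key
  rw [← norm_tau g, map_sub, ← tau_mul, mul_inv_cancel_left, norm_sub_rev]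
  refine key.trans ?_
  gcongr
  have hDD : (D : ℝ) * D ≤ D₀ * D₀ := by
    have : (D : ℝ) ≤ D₀ := by exact_mod_cast hD
    gcongr
  have : (D₀ : ℝ) * D₀ * η ≤ δ / 2 := by
    rw [hη, mul_div_assoc', div_le_iff₀ (by positivity)]
    nlinarith
  nlinarith

end Projection

section Extremal

variable {G : Type*} [Group G]

/-- The quadratic functional `‖Q f‖² - ‖f‖² / κ`. -/
def energy (U : Finset G) (κ : ℝ) (f : G →₀ ℝ) : ℝ := ‖avg U f‖ ^ 2 - κ⁻¹ * ‖f‖ ^ 2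

/-- Probability densities supported in `Ω`. -/
structure IsDensity {G : Type*} (Ω : Finset G) (f : G →₀ ℝ) : Prop where
  nonneg : ∀ x, 0 ≤ f x
  support : f.support ⊆ Ω
  sum_eq : ∑ x ∈ Ω, f x = 1

variable {U Ω : Finset G} {κ : ℝ} {f : G →₀ ℝ}

theorem energy_smul (c : ℝ) (f : G →₀ ℝ) : energy U κ (c • f) = c ^ 2 * energy U κ f := by
  simp only [energy, map_smul, norm_smul, mul_pow, Real.norm_eq_abs, sq_abs]
  ring

theorem energy_add (f g : G →₀ ℝ) : energy U κ (f + g) = energy U κ f + energy U κ g +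
    2 * (inner ℝ (avg U f) (avg U g) - κ⁻¹ * inner ℝ f g) := by
  simp only [energy, map_add, norm_add_sq_real]
  ring

theorem energy_tau (g : G) (f : G →₀ ℝ) : energy U κ (tau g f) = energy U κ f := by
  simp only [energy, ← tau_avg, norm_tau]

theorem exists_isMax_energy (hΩ : Ω.Nonempty) :
    ∃ f, IsDensity Ω f ∧ ∀ f', IsDensity Ω f' → energy U κ f' ≤ energy U κ f := by
  classical
  let ext : (Ω → ℝ) →ₗ[ℝ] (G →₀ ℝ) :=
    ∑ x : Ω, (LinearMap.proj x).smulRight (Finsupp.single (x : G) (1 : ℝ))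
  have hext : ∀ (v : Ω → ℝ) (x : Ω), ext v x = v x := by
    intro v x
    simp only [ext, LinearMap.sum_apply, LinearMap.smulRight_apply, LinearMap.proj_apply,
      Finsupp.finsetSum_apply, Finsupp.smul_apply, Finsupp.single_apply, smul_eq_mul]
    rw [Finset.sum_eq_single x]
    · simp
    · intro y _ hy
      rw [if_neg (fun h => hy (Subtype.ext h)), mul_zero]
    · simp
  have hext' : ∀ (v : Ω → ℝ) (x : G), x ∉ Ω → ext v x = 0 := by
    intro v x hx
    simp only [ext, LinearMap.sum_apply, LinearMap.smulRight_apply, LinearMap.proj_apply,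
      Finsupp.finsetSum_apply, Finsupp.smul_apply, Finsupp.single_apply, smul_eq_mul]
    refine Finset.sum_eq_zero fun y _ => ?_
    rw [if_neg (fun h : (y : G) = x => hx (h ▸ y.2)), mul_zero]
  have hcont : Continuous fun v => energy U κ (ext v) := by
    have h1 : Continuous ext := ext.continuous_of_finiteDimensional
    have h2 : Continuous (avg U ∘ₗ ext) := (avg U ∘ₗ ext).continuous_of_finiteDimensional
    exact (h2.norm.pow 2).sub ((h1.norm.pow 2).const_mul _)
  obtain ⟨x₀, hx₀⟩ := hΩ
  obtain ⟨v, hv, hmax⟩ := (isCompact_stdSimplex ℝ Ω).exists_isMaxOn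
    ⟨_, single_mem_stdSimplex ℝ (⟨x₀, hx₀⟩ : Ω)⟩ hcont.continuousOn
  refine ⟨ext v, ⟨fun x => ?_, fun x hx => ?_, ?_⟩, fun f' hf' => ?_⟩
  · by_cases hx : x ∈ Ω
    · exact (hext v ⟨x, hx⟩).symm ▸ hv.1 _
    · rw [hext' v x hx]
  · by_contra h
    exact (Finsupp.mem_support_iff.1 hx) (hext' v x h)
  · rw [← Finset.sum_coe_sort]
    simpa only [hext] using hv.2
  · have h1 : ext (fun x => f' x) = f' := by
      ext x
      by_cases hx : x ∈ Ω
      · exact hext _ ⟨x, hx⟩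
      · rw [hext' _ x hx]
        by_contra h
        exact hx (hf'.support (Finsupp.mem_support_iff.2 (Ne.symm h)))
    rw [← h1]
    refine hmax (show (fun x : Ω => f' x) ∈ stdSimplex ℝ Ω from ⟨fun x => hf'.nonneg x, ?_⟩)
    rw [Finset.sum_coe_sort Ω fun x => f' x]
    exact hf'.sum_eq

theorem IsDensity.exists_pos {G : Type*} {Ω : Finset G} {f : G →₀ ℝ} (hf : IsDensity Ω f) :
    ∃ x, 0 < f x := by
  by_contra! h
  have : ∑ x ∈ Ω, f x ≤ 0 := Finset.sum_nonpos fun x _ => h x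
  rw [hf.sum_eq] at this
  linarith

theorem IsDensity.sum_le_one {G : Type*} [DecidableEq G] {Ω : Finset G} {f : G →₀ ℝ}
    (hf : IsDensity Ω f) (s : Finset G) :
    ∑ x ∈ s, f x ≤ 1 := by
  rw [← hf.sum_eq, ← Finset.sum_subset (Finset.inter_subset_right (s₁ := Ω) (s₂ := s))]
  · exact Finset.sum_le_sum_of_subset_of_nonneg Finset.inter_subset_left
      fun x _ _ => hf.nonneg x
  · intro x hx hx'
    by_contra h
    exact hx' (Finset.mem_inter.2 ⟨hf.support (Finsupp.mem_support_iff.2 h), hx⟩)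

theorem first_order_le (hU : ∀ u ∈ U, u⁻¹ ∈ U) (hf : IsDensity Ω f)
    (hmax : ∀ f', IsDensity Ω f' → energy U κ f' ≤ energy U κ f) {z : G} (hz : z ∈ Ω) :
    avg U (avg U f) z - κ⁻¹ * f z ≤ energy U κ f := by
  classical
  set d : G →₀ ℝ := Finsupp.single z 1 - f with hd
  set b := inner ℝ (avg U f) (avg U d) - κ⁻¹ * inner ℝ f d with hb
  have hbval : b = avg U (avg U f) z - κ⁻¹ * f z - energy U κ f := by
    have e1 : inner ℝ (avg U (avg U f)) (Finsupp.single z 1) = avg U (avg U f) z := by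
      rw [real_inner_comm, inner_single]
    have e2 : inner ℝ f (Finsupp.single z 1) = f z := by rw [real_inner_comm, inner_single]
    rw [hb, ← inner_avg hU, hd, inner_sub_right, inner_sub_right, e1, e2,
      real_inner_self_eq_norm_sq, inner_avg hU, real_inner_self_eq_norm_sq, energy]
    ring
  have hden : ∀ t : ℝ, 0 ≤ t → t ≤ 1 → IsDensity Ω (f + t • d) := by
    intro t h0 h1
    have hval : ∀ x, (f + t • d) x = (1 - t) * f x + t * (Finsupp.single z (1 : ℝ)) x := by
      intro x
      simp only [hd, Finsupp.add_apply, Finsupp.smul_apply, Finsupp.sub_apply, smul_eq_mul]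
      ring
    have hs : ∀ x, 0 ≤ (Finsupp.single z (1 : ℝ)) x := fun x => by
      rw [Finsupp.single_apply]; split_ifs <;> simp
    refine ⟨fun x => ?_, fun x hx => ?_, ?_⟩
    · rw [hval]
      exact add_nonneg (mul_nonneg (by linarith) (hf.nonneg x)) (mul_nonneg h0 (hs x))
    · by_contra h
      rw [Finsupp.mem_support_iff, hval] at hx
      apply hx
      have h2 : f x = 0 := by
        by_contra h'
        exact h (hf.support (Finsupp.mem_support_iff.2 h'))
      rw [h2, Finsupp.single_apply, if_neg (fun h' : z = x => h (h' ▸ hz))]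
      simp
    · simp only [hval, Finset.sum_add_distrib, ← Finset.mul_sum, hf.sum_eq]
      simp only [Finsupp.single_apply]
      rw [Finset.sum_ite_eq, if_pos hz]
      ring
  have hineq : ∀ t : ℝ, 0 ≤ t → t ≤ 1 → t ^ 2 * energy U κ d + 2 * (t * b) ≤ 0 := by
    intro t h0 h1
    have := hmax _ (hden t h0 h1)
    rw [energy_add, energy_smul, map_smul, inner_smul_right, inner_smul_right] at this
    linear_combination this
  suffices b ≤ 0 by linarith
  by_contra! hpos
  set c := energy U κ d
  have hc : 0 ≤ |c| := abs_nonneg c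
  have hpos' : 0 < |c| + b := by linarith
  set t := b / (|c| + b) with ht
  have ht0 : 0 < t := div_pos hpos hpos'
  have h1 := hineq t ht0.le ((div_le_one hpos').2 (by linarith))
  have h2 : t * (|c| + b) = b := div_mul_cancel₀ _ hpos'.ne'
  have h3 : t * c + 2 * b ≤ 0 := by
    have : t * (t * c + 2 * b) ≤ 0 := by linear_combination h1
    exact nonpos_of_mul_nonpos_right this ht0
  nlinarith [neg_abs_le c]

theorem first_order_eq (hU : ∀ u ∈ U, u⁻¹ ∈ U) (hf : IsDensity Ω f)
    (hmax : ∀ f', IsDensity Ω f' → energy U κ f' ≤ energy U κ f) {z : G} (hz : 0 < f z) :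
    avg U (avg U f) z - κ⁻¹ * f z = energy U κ f := by
  have hzΩ : z ∈ Ω := hf.support (Finsupp.mem_support_iff.2 hz.ne')
  have h1 : ∑ x ∈ Ω, f x * (energy U κ f - (avg U (avg U f) x - κ⁻¹ * f x)) = 0 := by
    have e1 : inner ℝ f (avg U (avg U f)) = ∑ x ∈ Ω, f x * avg U (avg U f) x :=
      inner_eq_sum hf.support
    rw [inner_avg_avg_self hU] at e1
    have e2 := norm_sq_eq_sum hf.support
    have e3 : ∀ x, f x * (energy U κ f - (avg U (avg U f) x - κ⁻¹ * f x)) =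
        f x * energy U κ f - f x * avg U (avg U f) x + κ⁻¹ * f x ^ 2 := fun x => by ring
    rw [Finset.sum_congr rfl fun x _ => e3 x, Finset.sum_add_distrib, Finset.sum_sub_distrib,
      ← Finset.sum_mul, ← Finset.mul_sum, ← e1, ← e2, hf.sum_eq, energy]
    ring
  have h2 := (Finset.sum_eq_zero_iff_of_nonneg fun x hx => mul_nonneg (hf.nonneg x)
    (sub_nonneg.2 (first_order_le hU hf hmax hx))).1 h1 z hzΩ
  rcases mul_eq_zero.1 h2 with h | h
  · exact absurd h hz.ne'
  · linarith

theorem energy_le_of_nonneg (hmax : ∀ f', IsDensity Ω f' → energy U κ f' ≤ energy U κ f)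
    {g : G →₀ ℝ} (hg : ∀ x, 0 ≤ g x) (hs : g.support ⊆ Ω) (hpos : 0 < ∑ x ∈ Ω, g x) :
    energy U κ g ≤ (∑ x ∈ Ω, g x) ^ 2 * energy U κ f := by
  set m := ∑ x ∈ Ω, g x with hm
  have hd : IsDensity Ω (m⁻¹ • g) := by
    refine ⟨fun x => ?_, (Finsupp.support_smul).trans hs, ?_⟩
    · exact mul_nonneg (by positivity) (hg x)
    · simp only [Finsupp.smul_apply, smul_eq_mul, ← Finset.mul_sum, ← hm]
      exact inv_mul_cancel₀ hpos.ne'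
  have h1 := mul_le_mul_of_nonneg_left (hmax _ hd) (sq_nonneg m)
  rwa [energy_smul, ← mul_assoc, ← mul_pow, mul_inv_cancel₀ hpos.ne', one_pow, one_mul] at h1

theorem avg_avg_apply_le [DecidableEq G] (hf : ∀ x, 0 ≤ f x) (hne : U.Nonempty) (x : G) :
    avg U (avg U f) x ≤ (U.card : ℝ)⁻¹ * ∑ y ∈ x • U ^ 2, f y := by
  have hc : (0 : ℝ) < U.card := by exact_mod_cast hne.card_pos
  rw [avg_apply_apply]
  refine mul_le_mul_of_nonneg_left ?_ (by positivity)
  have h1 : ∀ u ∈ U, avg U f (x * u) ≤ (U.card : ℝ)⁻¹ * ∑ y ∈ x • U ^ 2, f y := by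
    intro u hu
    rw [avg_apply_apply]
    refine mul_le_mul_of_nonneg_left ?_ (by positivity)
    rw [← Finset.sum_image (f := fun y => f y) (s := U) (g := fun v => x * u * v)
      (fun a _ b _ h => by simpa using h)]
    refine Finset.sum_le_sum_of_subset_of_nonneg ?_ fun y _ _ => hf y
    intro y hy
    obtain ⟨v, hv, rfl⟩ := Finset.mem_image.1 hy
    rw [mul_assoc, sq]
    exact Finset.smul_mem_smul_finset (Finset.mul_mem_mul hu hv)
  refine (Finset.sum_le_card_nsmul _ _ _ h1).trans_eq ?_
  rw [nsmul_eq_mul, mul_inv_cancel_left₀ hc.ne']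

theorem exists_mem_shell [DecidableEq G] (hU : ∀ u ∈ U, u⁻¹ ∈ U) (hf : IsDensity Ω f)
    (hmax : ∀ f', IsDensity Ω f' → energy U κ f' ≤ energy U κ f) (hpos : 0 < energy U κ f)
    {x₀ y : G} (hx₀ : 0 < f x₀) (hy : 0 < f y) {s : Finset G} (hs : x₀ ∈ s) (hys : y ∉ s * U ^ 2)
    (h1 : 1 ∈ U) :
    ∃ z, 0 < f z ∧ z ∈ s * U ^ 2 ∧ z ∉ s := by
  by_contra! hcon
  set p := mulOp (fun x => if x ∈ s then 1 else 0) f with hp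
  set r := mulOp (fun x => if x ∈ s then 0 else 1) f with hr
  have hpv : ∀ x, p x = if x ∈ s then f x else 0 := fun x => by
    rw [hp, mulOp_apply]; split_ifs <;> simp
  have hrv : ∀ x, r x = if x ∈ s then 0 else f x := fun x => by
    rw [hr, mulOp_apply]; split_ifs <;> simp
  have hpr : p + r = f := by
    ext x; rw [Finsupp.add_apply, hpv, hrv]; split_ifs <;> simp
  have hp0 : ∀ x, 0 ≤ p x := fun x => by
    rw [hpv]; split_ifs; exacts [hf.nonneg x, le_rfl]
  have hr0 : ∀ x, 0 ≤ r x := fun x => by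
    rw [hrv]; split_ifs; exacts [le_rfl, hf.nonneg x]
  have hsub : ∀ g : G →₀ ℝ, (∀ x, f x = 0 → g x = 0) → g.support ⊆ Ω := fun g hg x hx =>
    hf.support (Finsupp.mem_support_iff.2 fun h => Finsupp.mem_support_iff.1 hx (hg x h))
  have hpΩ : p.support ⊆ Ω := hsub p fun x hx => by rw [hpv, hx, ite_self]
  have hrΩ : r.support ⊆ Ω := hsub r fun x hx => by rw [hrv, hx, ite_self]
  have hps : p.support ⊆ s := fun x hx => by
    by_contra h
    exact (Finsupp.mem_support_iff.1 hx) (by rw [hpv, if_neg h])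
  have hyS : y ∉ s := fun h => hys (by
    simpa using Finset.mul_mem_mul h (show (1 : G) ∈ U ^ 2 from Finset.one_mem_pow h1))
  have hdisj : ∀ x, avg U (avg U p) x * r x = 0 := by
    intro x
    by_contra hx
    have h2 : x ∈ s * U ^ 2 := by
      rw [sq, ← mul_assoc]
      exact support_avg_subset hU (support_avg_subset hU hps)
        (Finsupp.mem_support_iff.2 (left_ne_zero_of_mul hx))
    have h3 := right_ne_zero_of_mul hx
    rw [hrv] at h3
    split_ifs at h3 with h4
    · exact h3 rfl
    · exact h4 (hcon x (lt_of_le_of_ne (hf.nonneg x) (Ne.symm h3)) h2)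
  have hin1 : inner ℝ (avg U p) (avg U r) = 0 := by
    rw [← inner_avg hU, inner_eq_sum subset_rfl]
    exact Finset.sum_eq_zero fun x _ => hdisj x
  have hin2 : inner ℝ p r = 0 := by
    rw [inner_eq_sum subset_rfl]
    refine Finset.sum_eq_zero fun x _ => ?_
    rw [hpv, hrv]; split_ifs <;> simp
  have hE := energy_add (U := U) (κ := κ) p r
  rw [hpr, hin1, hin2] at hE
  have hsum : ∑ x ∈ Ω, p x + ∑ x ∈ Ω, r x = 1 := by
    rw [← Finset.sum_add_distrib, ← hf.sum_eq]
    exact Finset.sum_congr rfl fun x _ => by rw [← Finsupp.add_apply, hpr]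
  have hposp : 0 < ∑ x ∈ Ω, p x :=
    Finset.sum_pos' (fun x _ => hp0 x) ⟨x₀, hf.support (Finsupp.mem_support_iff.2 hx₀.ne'), by
      rw [hpv, if_pos hs]; exact hx₀⟩
  have hposr : 0 < ∑ x ∈ Ω, r x :=
    Finset.sum_pos' (fun x _ => hr0 x) ⟨y, hf.support (Finsupp.mem_support_iff.2 hy.ne'), by
      rw [hrv, if_neg hyS]; exact hy⟩
  have e1 := energy_le_of_nonneg hmax hp0 hpΩ hposp
  have e2 := energy_le_of_nonneg hmax hr0 hrΩ hposr
  set a := ∑ x ∈ Ω, p x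
  set b := ∑ x ∈ Ω, r x
  have hb : b = 1 - a := by linarith
  have : energy U κ f ≤ (a ^ 2 + b ^ 2) * energy U κ f := by linarith
  have h5 : 1 ≤ a ^ 2 + b ^ 2 := le_of_mul_le_mul_right (by linarith) hpos
  nlinarith [mul_pos hposp hposr]

theorem sq_le_norm_avg_sq_mul_card [DecidableEq G] (hU : ∀ u ∈ U, u⁻¹ ∈ U) (hne : U.Nonempty)
    {S : Finset G} {c : ℝ} (hc : 0 ≤ c) (hf : ∀ x, 0 ≤ f x) (hfS : ∀ x ∈ S, c ≤ f x) :
    (c * S.card) ^ 2 ≤ ‖avg U f‖ ^ 2 * (S * U).card := by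
  have hUc : (U.card : ℝ) ≠ 0 := by exact_mod_cast hne.card_pos.ne'
  set w := restrict (S * U) fun _ => (1 : ℝ) with hw
  have hw0 : ∀ x, 0 ≤ w x := fun x => by
    by_cases h : x ∈ S * U
    · rw [hw, restrict_apply_of_mem h]; exact zero_le_one
    · rw [hw, restrict_apply_of_notMem h]
  have h1 : ∀ x ∈ S, avg U w x = 1 := fun x hx => by
    rw [avg_apply_apply, Finset.sum_congr rfl fun u hu =>
      restrict_apply_of_mem (Finset.mul_mem_mul hx hu)]
    simp [hUc]
  have h2 : c * S.card ≤ inner ℝ (avg U f) w := by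
    rw [inner_avg hU, inner_eq_sum (s := f.support ∪ S) Finset.subset_union_left]
    calc c * S.card = ∑ x ∈ S, c := by rw [Finset.sum_const, nsmul_eq_mul, mul_comm]
      _ ≤ ∑ x ∈ S, f x * avg U w x :=
        Finset.sum_le_sum fun x hx => by rw [h1 x hx, mul_one]; exact hfS x hx
      _ ≤ _ := Finset.sum_le_sum_of_subset_of_nonneg Finset.subset_union_right
        fun x _ _ => mul_nonneg (hf x) (avg_mono hw0 x)
  have h3 := h2.trans (real_inner_le_norm _ _)
  rw [← norm_indicator (S * U), ← mul_pow]
  exact pow_le_pow_left₀ (by positivity) h3 2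

theorem IsDensity.tau [DecidableEq G] (hf : IsDensity Ω f) {g : G} {Ω' : Finset G}
    (h : (tau g f).support ⊆ Ω') : IsDensity Ω' (tau g f) := by
  refine ⟨fun x => by rw [tau_apply]; exact hf.nonneg _, h, ?_⟩
  have h1 : (FinsuppHilbert.tau g f).support ⊆ g • Ω := support_tau_subset g hf.support
  rw [← hf.sum_eq]
  have h2 : ∑ x ∈ g • Ω, FinsuppHilbert.tau g f x = ∑ x ∈ Ω, f x := by
    rw [Finset.smul_finset_def, Finset.sum_image fun a _ b _ h => by simpa using h]
    exact Finset.sum_congr rfl fun x _ => by rw [tau_apply, smul_eq_mul, inv_mul_cancel_left]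
  rw [← h2, ← Finset.sum_subset h, ← Finset.sum_subset h1] <;>
  exact fun x _ hx => by simpa using hx

theorem support_subset_of_isMax [DecidableEq G] (hU : ∀ u ∈ U, u⁻¹ ∈ U) (hone : 1 ∈ U) {k : ℕ}
    (hk : 0 < k) (hf : IsDensity Ω f)
    (hmax : ∀ f', IsDensity Ω f' → energy U k f' ≤ energy U k f)
    (hE : 1 ≤ k * U.card * energy U k f) {x₀ : G} (hx₀ : 0 < f x₀) :
    f.support ⊆ x₀ • U ^ (6 * k + 2) := by
  have hUc : (0 : ℝ) < U.card := by exact_mod_cast Finset.card_pos.2 ⟨1, hone⟩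
  have hk' : (0 : ℝ) < k := by exact_mod_cast hk
  have hpos : 0 < energy U k f := by
    by_contra! h
    nlinarith [mul_pos hk' hUc]
  intro y hy
  by_contra hyn
  have hy0 : 0 < f y := lt_of_le_of_ne (hf.nonneg y) (Ne.symm (Finsupp.mem_support_iff.1 hy))
  have hmono : ∀ {a b : ℕ}, a ≤ b → x₀ • U ^ a ⊆ x₀ • U ^ b := fun h =>
    Finset.smul_finset_subset_smul_finset (Finset.pow_subset_pow_right hone h)
  have hex : ∀ j : ℕ, j ≤ k → ∃ z, 0 < f z ∧ z ∈ x₀ • U ^ (6 * j + 2) ∧ z ∉ x₀ • U ^ (6 * j) := by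
    intro j hj
    have h1 := exists_mem_shell hU hf hmax hpos hx₀ hy0 (s := x₀ • U ^ (6 * j))
      (by simpa using Finset.smul_mem_smul_finset (a := x₀)
            (show (1 : G) ∈ U ^ (6 * j) from Finset.one_mem_pow hone))
      (by
        rw [smul_mul_assoc, ← pow_add]
        exact fun h => hyn (hmono (by omega) h)) hone
    rwa [smul_mul_assoc, ← pow_add] at h1
  choose! z hz0 hz1 hz2 using hex
  have hmass : ∀ j ∈ Finset.range (k + 1), (k : ℝ)⁻¹ ≤ ∑ y ∈ z j • U ^ 2, f y := by
    intro j hj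
    have hj' : j ≤ k := by simpa [Nat.lt_succ_iff] using hj
    have h1 := first_order_eq hU hf hmax (hz0 j hj')
    have h2 := avg_avg_apply_le hf.nonneg ⟨1, hone⟩ (z j)
    rw [le_inv_mul_iff₀ hUc] at h2
    have h3 : 0 ≤ (k : ℝ)⁻¹ * f (z j) := mul_nonneg (by positivity) (hf.nonneg _)
    rw [inv_le_iff_one_le_mul₀ hk']
    have h4 : U.card * energy U k f ≤ ∑ y ∈ z j • U ^ 2, f y :=
      le_trans (mul_le_mul_of_nonneg_left (by linarith) hUc.le) h2
    nlinarith
  have hdisj : ∀ i j, i < j → j ≤ k → Disjoint (z i • U ^ 2) (z j • U ^ 2) := by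
    intro i j hij hj
    rw [Finset.disjoint_left]
    intro w hwi hwj
    apply hz2 j hj
    obtain ⟨a, ha, rfl⟩ := Finset.mem_smul_finset.1 hwi
    obtain ⟨b, hb, hab⟩ := Finset.mem_smul_finset.1 hwj
    obtain ⟨c, hc, hcz⟩ := Finset.mem_smul_finset.1 (hz1 i (hij.le.trans hj))
    have hb' : b⁻¹ ∈ U ^ 2 := by
      rw [sq] at hb ⊢
      obtain ⟨p, hp, q, hq, rfl⟩ := Finset.mem_mul.1 hb
      rw [mul_inv_rev]
      exact Finset.mul_mem_mul (hU q hq) (hU p hp)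
    refine hmono (show 6 * i + 2 + 2 + 2 ≤ 6 * j by omega)
      (Finset.mem_smul_finset.2 ⟨c * a * b⁻¹, ?_, ?_⟩)
    · rw [pow_add _ (6 * i + 2 + 2), pow_add _ (6 * i + 2)]
      exact Finset.mul_mem_mul (Finset.mul_mem_mul hc ha) hb'
    · simp only [smul_eq_mul] at hab hcz ⊢
      rw [← mul_assoc, ← mul_assoc, hcz, ← hab, mul_inv_cancel_right]
  have hpd : ((Finset.range (k + 1) : Finset ℕ) : Set ℕ).PairwiseDisjoint
      fun j => z j • U ^ 2 := by
    intro i hi j hj hij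
    simp only [Finset.coe_range, Set.mem_Iio] at hi hj
    rcases lt_or_gt_of_ne hij with h | h
    · exact hdisj i j h (by omega)
    · exact (hdisj j i h (by omega)).symm
  have h1 := hf.sum_le_one ((Finset.range (k + 1)).biUnion fun j => z j • U ^ 2)
  rw [Finset.sum_biUnion hpd] at h1
  have h2 := Finset.card_nsmul_le_sum _ _ _ hmass
  rw [Finset.card_range, nsmul_eq_mul] at h2
  have h3 : (1 : ℝ) < (k + 1 : ℕ) * (k : ℝ)⁻¹ := by
    rw [← div_eq_mul_inv, one_lt_div hk']
    push_cast
    linarith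
  linarith

/-- A compactly supported solution of a nonlinear fixed point equation for the averaging operator
of a set of small doubling. -/
theorem exists_fixed_point [DecidableEq G] (hU : ∀ u ∈ U, u⁻¹ ∈ U) (hone : 1 ∈ U) {K : ℕ}
    (hK : (U * U).card ≤ K * U.card) :
    ∃ (f : G →₀ ℝ) (l : ℝ), 0 < l ∧ f ≠ 0 ∧ f.support ⊆ U ^ (12 * K + 2) ∧
      ∀ x, f x = 2 * K * max 0 (avg U (avg U f) x - l) := by
  have hne : U.Nonempty := ⟨1, hone⟩
  have hUc : (0 : ℝ) < U.card := by exact_mod_cast hne.card_pos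
  have hK0 : 0 < K := by
    have h1 : 0 < (U * U).card := (hne.mul hne).card_pos
    exact Nat.pos_of_ne_zero fun h => by rw [h, zero_mul] at hK; omega
  have hK0' : (0 : ℝ) < K := by exact_mod_cast hK0
  set m := 12 * K + 2 with hm
  have hmono : ∀ {a b : ℕ}, a ≤ b → U ^ a ⊆ U ^ b := fun h => Finset.pow_subset_pow_right hone h
  set Ω := U ^ (m + 2) with hΩ
  obtain ⟨f, hf, hmax⟩ := exists_isMax_energy (U := U) (κ := (2 * K : ℕ)) (Ω := Ω)
    ⟨1, Finset.one_mem_pow hone⟩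
  have hE : 1 ≤ (2 * K : ℕ) * U.card * energy U (2 * K : ℕ) f := by
    set ind := restrict U fun _ => (1 : ℝ) with hind
    have h0 : ∀ x, 0 ≤ ind x := fun x => by
      by_cases h : x ∈ U
      · rw [hind, restrict_apply_of_mem h]; exact zero_le_one
      · rw [hind, restrict_apply_of_notMem h]
    have hUΩ : U ⊆ Ω := by simpa using hmono (show 1 ≤ m + 2 by omega)
    have hs : ∑ x ∈ Ω, ind x = U.card := by
      rw [← Finset.sum_subset hUΩ fun x _ hx => restrict_apply_of_notMem hx,
        Finset.sum_congr rfl fun x hx => restrict_apply_of_mem hx]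
      simp
    have h1 := energy_le_of_nonneg hmax h0 ((support_restrict_subset U _).trans hUΩ)
      (by rw [hs]; exact hUc)
    rw [hs, energy, hind, norm_indicator] at h1
    have h2 := sq_le_norm_avg_sq_mul_card hU hne zero_le_one h0 (S := U)
      fun x hx => by rw [hind, restrict_apply_of_mem hx]
    rw [one_mul] at h2
    have h3 : ((U * U).card : ℝ) ≤ K * U.card := by exact_mod_cast hK
    have h4 : (U.card : ℝ) ^ 2 ≤ ‖avg U ind‖ ^ 2 * (K * U.card) :=
      h2.trans (mul_le_mul_of_nonneg_left h3 (by positivity))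
    have h5 : (U.card : ℝ) ≤ K * ‖avg U ind‖ ^ 2 := by
      refine le_of_mul_le_mul_right ?_ hUc
      linarith
    push_cast at h1 ⊢
    have h6 : 2 * K * (‖avg U ind‖ ^ 2 - (2 * (K : ℝ))⁻¹ * U.card) ≤
        2 * K * (U.card ^ 2 * energy U (2 * K) f) := by
      gcongr
    rw [mul_sub, mul_inv_cancel_left₀ (by positivity)] at h6
    have h7 : (U.card : ℝ) * 1 ≤ U.card * (2 * K * U.card * energy U (2 * K) f) := by linarith
    exact le_of_mul_le_mul_left h7 hUc
  obtain ⟨x₀, hx₀⟩ := hf.exists_pos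
  have hsupp := support_subset_of_isMax hU hone (by omega) hf hmax hE hx₀
  set g := tau x₀⁻¹ f with hg
  have hgs : g.support ⊆ U ^ m := by
    have := support_tau_subset x₀⁻¹ hsupp
    rwa [inv_smul_smul, show 6 * (2 * K) + 2 = m by omega] at this
  have hgd : IsDensity Ω g := hf.tau (hgs.trans (hmono (by omega)))
  have hgE : energy U (2 * K : ℕ) g = energy U (2 * K : ℕ) f := energy_tau _ _
  rw [← hgE] at hmax hE
  have hl : 0 < energy U (2 * K : ℕ) g := by
    by_contra! h
    have : (0 : ℝ) ≤ (2 * K : ℕ) * U.card := by positivity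
    nlinarith
  refine ⟨g, energy U (2 * K : ℕ) g, hl, fun h => ?_, hgs, fun x => ?_⟩
  · obtain ⟨x, hx⟩ := hgd.exists_pos
    simp [h] at hx
  rcases (hgd.nonneg x).eq_or_lt with h | h
  · rw [← h, max_eq_left, mul_zero]
    by_cases hx : x ∈ Ω
    · have := first_order_le hU hgd hmax hx
      rw [← h] at this
      linarith
    · have : avg U (avg U g) x = 0 := by
        by_contra hne
        refine hx ?_
        rw [hΩ, pow_add, sq, ← mul_assoc]
        exact support_avg_subset hU (support_avg_subset hU hgs) (Finsupp.mem_support_iff.2 hne)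
      rw [this]; linarith
  · have h1 := first_order_eq hU hgd hmax h
    have h2 : avg U (avg U g) x - energy U (2 * K : ℕ) g = ((2 * K : ℕ) : ℝ)⁻¹ * g x := by linarith
    rw [h2, max_eq_right (by positivity)]
    push_cast
    rw [mul_inv_cancel_left₀ (by positivity)]

end Extremal

section Escape

variable {G : Type*} [Group G]

theorem tau_pow_sub (g : G) (v : G →₀ ℝ) (n : ℕ) :
    tau (g ^ n) v - v = n • (tau g v - v) +
      ∑ i ∈ Finset.range n, (tau (g ^ i) (tau g v - v) - (tau g v - v)) := by
  induction n with
  | zero => simp [tau_one]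
  | succ n ih =>
    have h : tau (g ^ (n + 1)) v - v = tau (g ^ n) (tau g v - v) + (tau (g ^ n) v - v) := by
      rw [pow_succ, tau_mul, map_sub]; abel
    rw [h, ih, Finset.sum_range_succ, succ_nsmul]
    abel

theorem le_norm_tau_pow_sub {g : G} {v : G →₀ ℝ} {n : ℕ} {η : ℝ}
    (h : ∀ i < n, ‖tau (g ^ i) (tau g v - v) - (tau g v - v)‖ ≤ η) :
    n * (‖tau g v - v‖ - η) ≤ ‖tau (g ^ n) v - v‖ := by
  rw [tau_pow_sub]
  have h1 : ‖∑ i ∈ Finset.range n, (tau (g ^ i) (tau g v - v) - (tau g v - v))‖ ≤ n * η := by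
    refine (norm_sum_le _ _).trans ?_
    refine (Finset.sum_le_card_nsmul _ _ η fun i hi => h i (Finset.mem_range.1 hi)).trans_eq ?_
    rw [Finset.card_range, nsmul_eq_mul]
  have h2 := norm_sub_le_norm_add (n • (tau g v - v))
    (∑ i ∈ Finset.range n, (tau (g ^ i) (tau g v - v) - (tau g v - v)))
  rw [← Nat.cast_smul_eq_nsmul ℝ n (tau g v - v), norm_smul, Real.norm_natCast] at h2
  rw [← Nat.cast_smul_eq_nsmul ℝ n (tau g v - v)]
  linarith

theorem mem_mul_inv_of_norm_tau_sub_lt [DecidableEq G] {v : G →₀ ℝ} {s : Finset G}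
    (hs : v.support ⊆ s) {g : G} (hg : ‖tau g v - v‖ ^ 2 < 2 * ‖v‖ ^ 2) : g ∈ s * s⁻¹ := by
  by_contra h
  have hd : Disjoint (tau g v).support v.support := by
    rw [Finset.disjoint_left]
    intro x hx hx'
    obtain ⟨y, hy, rfl⟩ := Finset.mem_smul_finset.1 (support_tau_subset g hs hx)
    exact h (Finset.mem_mul.2 ⟨g • y, hs hx', y⁻¹, Finset.inv_mem_inv hy, by simp⟩)
  rw [norm_sub_sq_of_disjoint hd, norm_tau] at hg
  linarith

theorem mulOp_tau (χ : G → ℝ) (g : G) (w : G →₀ ℝ) :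
    tau g (mulOp χ w) = mulOp (fun x => χ (g⁻¹ * x)) (tau g w) := by
  ext x
  rw [tau_apply, mulOp_apply, mulOp_apply, tau_apply]

section localAvg

variable {U : Finset G} {χ : G → ℝ}

theorem norm_mulOp_sub_le {G : Type*} {χ χ' : G → ℝ} {ε : ℝ} (hε : 0 ≤ ε)
    (h : ∀ x, |χ x - χ' x| ≤ ε) (w : G →₀ ℝ) : ‖mulOp χ w - mulOp χ' w‖ ≤ ε * ‖w‖ := by
  have : mulOp χ w - mulOp χ' w = mulOp (fun x => χ x - χ' x) w := by
    ext x
    simp only [Finsupp.sub_apply, mulOp_apply]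
    ring
  rw [this]
  exact norm_mulOp_le hε h w

theorem norm_localAvg_tau_sub_le (hχ : ∀ x, |χ x| ≤ 1) {g : G} {ε : ℝ} (hε : 0 ≤ ε)
    (h : ∀ x, |χ (g⁻¹ * x) - χ x| ≤ ε) (w : G →₀ ℝ) :
    ‖localAvg U χ (tau g w) - tau g (localAvg U χ w)‖ ≤ 2 * ε * ‖w‖ := by
  set χ' := fun x => χ (g⁻¹ * x) with hχ'
  have h' : ∀ x, |χ x - χ' x| ≤ ε := fun x => by rw [abs_sub_comm]; exact h x
  have e1 : tau g (localAvg U χ w) = mulOp χ' (avg U (avg U (mulOp χ' (tau g w)))) := by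
    rw [localAvg_apply, mulOp_tau, tau_avg, tau_avg, mulOp_tau]
  set y := tau g w with hy
  have hyn : ‖y‖ = ‖w‖ := norm_tau g w
  have e2 : localAvg U χ y - tau g (localAvg U χ w) =
      mulOp χ (avg U (avg U (mulOp χ y - mulOp χ' y))) +
      (mulOp χ (avg U (avg U (mulOp χ' y))) - mulOp χ' (avg U (avg U (mulOp χ' y)))) := by
    rw [e1, localAvg_apply]
    simp only [map_sub]
    abel
  have a1 : ‖mulOp χ (avg U (avg U (mulOp χ y - mulOp χ' y)))‖ ≤ ε * ‖w‖ := by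
    refine (norm_mulOp_le zero_le_one hχ _).trans ?_
    rw [one_mul, ← hyn]
    exact (norm_avg_le _ _).trans ((norm_avg_le _ _).trans (norm_mulOp_sub_le hε h' y))
  have a2 : ‖avg U (avg U (mulOp χ' y))‖ ≤ ‖w‖ := by
    refine (norm_avg_le _ _).trans ((norm_avg_le _ _).trans ?_)
    rw [← hyn]
    simpa using norm_mulOp_le zero_le_one (fun x => hχ (g⁻¹ * x)) y
  have a3 := norm_mulOp_sub_le hε h' (avg U (avg U (mulOp χ' y)))
  rw [e2]
  refine (norm_add_le _ _).trans ?_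
  nlinarith

theorem norm_tau_localAvg_sub_le {Ω : Finset G} (hχ : ∀ x, |χ x| ≤ 1)
    (hΩ : ∀ x, χ x ≠ 0 → x ∈ Ω) {g : G} {ε δ : ℝ} (hε : 0 ≤ ε) (hδ : 0 ≤ δ)
    (h : ∀ x, |χ (g⁻¹ * x) - χ x| ≤ ε) (hg : Small U Ω δ g) (w : G →₀ ℝ) :
    ‖tau g (localAvg U χ w) - localAvg U χ w‖ ≤ (ε + δ) * ‖w‖ := by
  set y := mulOp χ w with hy
  have hyn : ‖y‖ ≤ ‖w‖ := by simpa using norm_mulOp_le zero_le_one hχ w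
  have e : tau g (localAvg U χ w) - localAvg U χ w =
      (mulOp (fun x => χ (g⁻¹ * x)) (tau g (avg U (avg U y))) -
        mulOp χ (tau g (avg U (avg U y)))) +
      mulOp χ (tau g (avg U (avg U y)) - avg U (avg U y)) := by
    rw [localAvg_apply, mulOp_tau, map_sub]
    abel
  have a1 := norm_mulOp_sub_le hε h (tau g (avg U (avg U y)))
  rw [norm_tau] at a1
  have a2 : ‖avg U (avg U y)‖ ≤ ‖w‖ := (norm_avg_le _ _).trans ((norm_avg_le _ _).trans hyn)
  have a3 : ‖mulOp χ (tau g (avg U (avg U y)) - avg U (avg U y))‖ ≤ δ * ‖w‖ := by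
    refine (norm_mulOp_le zero_le_one hχ _).trans ?_
    rw [one_mul]
    exact (hg y (support_mulOp_subset hΩ w)).trans (mul_le_mul_of_nonneg_left hyn hδ)
  rw [e]
  refine (norm_add_le _ _).trans ?_
  nlinarith

end localAvg

section gap

variable {G : Type*} {D : ℕ} {e : Fin D → (G →₀ ℝ)} {T : (G →₀ ℝ) →ₗ[ℝ] (G →₀ ℝ)} {l : Fin D → ℝ}

theorem map_proj (hT : T.IsSymmetric) (hl : ∀ i, T (e i) = l i • e i) (v : G →₀ ℝ) :
    T (proj e v) = proj e (T v) := by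
  simp only [proj, map_sum, map_smul, hl]
  refine Finset.sum_congr rfl fun i _ => ?_
  rw [← hT (e i) v, hl, real_inner_smul_left, smul_smul, mul_comm]

theorem proj_apply_self (he : Orthonormal ℝ e) (i : Fin D) : proj e (e i) = e i := by
  rw [proj, Finset.sum_eq_single i]
  · rw [real_inner_self_eq_norm_sq, he.1 i]; simp
  · intro j _ hj
    rw [he.2 hj, zero_smul]
  · simp

theorem proj_sub (u v : G →₀ ℝ) : proj e (u - v) = proj e u - proj e v := by
  simp only [proj, inner_sub_right, sub_smul, Finset.sum_sub_distrib]

theorem norm_sub_proj_le_of_gap (he : Orthonormal ℝ e) (hT : T.IsSymmetric)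
    (hl : ∀ i, T (e i) = l i • e i) {θ γ : ℝ} (hγ : 0 < γ)
    (hperp : ∀ v, (∀ i, inner ℝ (e i) v = 0) → ‖T v‖ ≤ (θ - γ) * ‖v‖) {a : ℝ} (ha : θ ≤ a)
    (w : G →₀ ℝ) : ‖w - proj e w‖ ≤ ‖T w - a • w‖ / γ := by
  rw [le_div_iff₀ hγ]
  set r := w - proj e w with hr
  have h0 : ∀ i, inner ℝ (e i) r = 0 := inner_sub_proj he w
  have h1 : inner ℝ r (T w - a • w) = inner ℝ r (T r) - a * ‖r‖ ^ 2 := by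
    have hw : w = proj e w + r := by rw [hr]; abel
    have hp : ∀ v, inner ℝ r (proj e v) = 0 := fun v => by
      rw [proj, inner_sum]
      refine Finset.sum_eq_zero fun i _ => ?_
      rw [real_inner_smul_right, real_inner_comm (e i) r, h0 i, mul_zero]
    conv_lhs => rw [hw]
    rw [map_add, inner_sub_right, inner_add_right, map_proj hT hl, hp, real_inner_smul_right,
      inner_add_right, hp, real_inner_self_eq_norm_sq]
    ring
  have h2 := abs_real_inner_le_norm r (T w - a • w)
  have h3 := real_inner_le_norm r (T r)
  have h4 := mul_le_mul_of_nonneg_left (hperp r h0) (norm_nonneg r)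
  rw [h1] at h2
  have h5 := neg_le_of_abs_le h2
  have h6 : γ * ‖r‖ ^ 2 ≤ ‖r‖ * ‖T w - a • w‖ := by nlinarith [sq_nonneg ‖r‖]
  rcases (norm_nonneg r).eq_or_lt with h | h
  · rw [← h, zero_mul]; positivity
  · refine le_of_mul_le_mul_left ?_ h
    linarith

end gap

theorem norm_tau_proj_sub_le {D : ℕ} {e : Fin D → (G →₀ ℝ)} (he : Orthonormal ℝ e) (g : G)
    (v : G →₀ ℝ) :
    ‖tau g (proj e v) - proj e v‖ ≤ (∑ i, ‖tau g (e i) - e i‖) * ‖v‖ := by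
  have : tau g (proj e v) - proj e v = ∑ i, inner ℝ (e i) v • (tau g (e i) - e i) := by
    simp only [proj, map_sum, map_smul, smul_sub, Finset.sum_sub_distrib]
  rw [this, Finset.sum_mul]
  refine (norm_sum_le _ _).trans (Finset.sum_le_sum fun i _ => ?_)
  rw [norm_smul, mul_comm, Real.norm_eq_abs]
  exact mul_le_mul_of_nonneg_left (abs_inner_le_norm he v i) (norm_nonneg _)

/-- A unit vector `φ = Q² f` such that the derivatives of `f` are controlled by those of `φ`. -/
theorem exists_gleason_function [DecidableEq G] {A : Finset G} (hA : ∀ a ∈ A, a⁻¹ ∈ A)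
    (hone : 1 ∈ A) {K : ℕ} (hK : (A * A).card ≤ K * A.card) :
    ∃ f : G →₀ ℝ, ‖avg A (avg A f)‖ = 1 ∧ f.support ⊆ A ^ (12 * K + 2) ∧
      ‖f‖ ≤ 2 * K ∧
      ∀ g, ‖tau g f - f‖ ≤ 2 * K * ‖tau g (avg A (avg A f)) - avg A (avg A f)‖ := by
  obtain ⟨f, l, hl, hf0, hfs, hf⟩ := exists_fixed_point hA hone hK
  set φ := avg A (avg A f) with hφ
  have hfn : ∀ x, 0 ≤ f x := fun x => by rw [hf]; positivity
  have hφn : ∀ x, 0 ≤ φ x := avg_mono (avg_mono hfn)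
  have h1 : ‖f‖ ≤ 2 * K * ‖φ‖ := by
    refine norm_le_of_abs_le (by positivity) fun x => ?_
    rw [abs_of_nonneg (hfn x), abs_of_nonneg (hφn x), hf]
    exact mul_le_mul_of_nonneg_left (max_le (hφn x) (by linarith)) (by positivity)
  have h2 : ∀ g, ‖tau g f - f‖ ≤ 2 * K * ‖tau g φ - φ‖ := by
    intro g
    refine norm_le_of_abs_le (by positivity) fun x => ?_
    simp only [Finsupp.sub_apply, tau_apply]
    rw [hf, hf, ← mul_sub, abs_mul, abs_of_nonneg (by positivity : (0 : ℝ) ≤ 2 * K)]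
    refine mul_le_mul_of_nonneg_left ?_ (by positivity)
    refine (abs_max_sub_max_le_max _ _ _ _).trans ?_
    rw [sub_self, abs_zero, sub_sub_sub_cancel_right]
    exact max_le (abs_nonneg _) le_rfl
  have hφ0 : 0 < ‖φ‖ := by
    rw [norm_pos_iff]
    intro h
    rw [h, norm_zero, mul_zero] at h1
    exact hf0 (norm_le_zero_iff.1 h1)
  have hs : avg A (avg A (‖φ‖⁻¹ • f)) = ‖φ‖⁻¹ • φ := by rw [map_smul, map_smul]
  have hsub : ∀ (g : G) (v : G →₀ ℝ), ‖tau g (‖φ‖⁻¹ • v) - ‖φ‖⁻¹ • v‖ = ‖φ‖⁻¹ * ‖tau g v - v‖ :=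
    fun g v => by rw [map_smul, ← smul_sub, norm_smul, norm_inv, norm_norm]
  refine ⟨‖φ‖⁻¹ • f, ?_, Finsupp.support_smul.trans hfs, ?_, fun g => ?_⟩
  · rw [hs, norm_smul, norm_inv, norm_norm, inv_mul_cancel₀ hφ0.ne']
  · rw [norm_smul, norm_inv, norm_norm, inv_mul_le_iff₀ hφ0]
    linarith
  · rw [hs, hsub, hsub, mul_left_comm]
    exact mul_le_mul_of_nonneg_left (h2 g) (by positivity)

end Escape

set_option maxHeartbeats 400000 in
theorem exists_escapeNorm_of_averaging {G : Type*} [Group G] [DecidableEq G]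
    {A U Ω Ωf Ωχ : Finset G} (hA : ∀ a ∈ A, a⁻¹ ∈ A) {b : ℝ} (hb : 1 ≤ b) {f : G →₀ ℝ}
    (hfs : f.support ⊆ Ωf) (hφ1 : ‖avg A (avg A f)‖ = 1) (hfb : ‖f‖ ≤ b)
    (hder : ∀ g, ‖tau g f - f‖ ≤ b * ‖tau g (avg A (avg A f)) - avg A (avg A f)‖)
    (hΩχ : Ωf * A * A * (Ωf * A * A)⁻¹ ⊆ Ωχ) (hΩf : Ωf ⊆ Ω) (hΩ : Ωχ * Ωf ⊆ Ω)
    (hU : ∀ u ∈ U, u⁻¹ ∈ U) (hU1 : 1 ∈ U) (hUs : ∀ u ∈ U, Small A Ω (1 / (24 * b)) u)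
    {t R : ℝ} (hR : 0 < R) (ht : (Ωχ.card : ℝ) ≤ t * U.card)
    (hUU : ((U * U).card : ℝ) ≤ R * U.card) {θ : ℝ} (hθ : θ = 1 / (32 * R)) {D₀ : ℕ}
    (hD₀ : 2 * t / θ ≤ D₀) {M : ℝ} (hM : M = 1 + 64 * D₀ * (D₀ + 1) / θ) :
    ∃ N : G → ℝ, (∀ g, 0 ≤ N g) ∧ N 1 = 0 ∧ (∀ g, N g⁻¹ = N g) ∧
      (∀ g h, N (g * h) ≤ N g + N h) ∧
      (∀ (g : G) (n : ℕ), (∀ i ≤ n, N (g ^ i) ≤ 1 / 4) → n / 2 * N g ≤ N (g ^ n)) ∧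
      (∀ g, N g ≤ 1 / 4 → g ∈ U ^ 6) ∧
      ∀ δ h, 0 ≤ δ → Small A Ω δ h → Small U Ωχ δ h →
        N h ≤ δ * (M * b + 2 * D₀ * (2 * b + 1) / θ) := by
  have hb0 : 0 < b := by linarith
  have hθ0 : 0 < θ := by rw [hθ]; positivity
  have hUne : U.Nonempty := ⟨1, hU1⟩
  have hUc : (0 : ℝ) < U.card := by exact_mod_cast hUne.card_pos
  set φ := avg A (avg A f) with hφ
  set N₁ : G → ℝ := fun g => ‖tau g φ - φ‖ with hN₁
  have hN₁0 : ∀ g, 0 ≤ N₁ g := fun g => norm_nonneg _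
  have hN₁mul : ∀ g h, N₁ (g * h) ≤ N₁ g + N₁ h := fun g h => norm_tau_mul_sub_le g h φ
  have hN₁inv : ∀ g, N₁ g⁻¹ = N₁ g := fun g => norm_tau_inv_sub g φ
  have hmem : ∀ g, N₁ g ≤ 1 → g ∈ Ωχ := by
    intro g hg
    refine hΩχ (mem_mul_inv_of_norm_tau_sub_lt
      (support_avg_subset hA (support_avg_subset hA hfs)) (v := φ) ?_)
    rw [hφ1]
    nlinarith [hN₁0 g, show N₁ g = ‖tau g φ - φ‖ from rfl]
  have hN₁small : ∀ {δ h}, 0 ≤ δ → Small A Ω δ h → N₁ h ≤ δ * b := fun hδ hh =>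
    (hh f (hfs.trans hΩf)).trans (mul_le_mul_of_nonneg_left hfb hδ)
  have hcomm : ∀ {δ g h}, 0 ≤ δ → Small A Ω δ h → N₁ g ≤ 1 →
      ‖tau h (tau g φ - φ) - (tau g φ - φ)‖ ≤ δ * (b * N₁ g) := by
    intro δ g h hδ hh hg
    have e : tau g φ - φ = avg A (avg A (tau g f - f)) := by
      rw [hφ, tau_avg, tau_avg, map_sub, map_sub]
    rw [e]
    refine (hh _ ?_).trans (mul_le_mul_of_nonneg_left (hder g) hδ)
    refine Finsupp.support_sub.trans (Finset.union_subset ?_ (hfs.trans hΩf))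
    exact (support_tau_subset g hfs).trans
      ((Finset.smul_finset_subset_mul (hmem g hg)).trans hΩ)
  set χ : G → ℝ := fun x => max 0 (1 - 2 * N₁ x) with hχ
  have hχ0 : ∀ x, 0 ≤ χ x := fun x => le_max_left _ _
  have hχ1 : ∀ x, |χ x| ≤ 1 := fun x => by
    rw [abs_of_nonneg (hχ0 x)]
    exact max_le zero_le_one (by linarith [hN₁0 x])
  have hχs : ∀ x, χ x ≠ 0 → x ∈ Ωχ := by
    intro x hx
    refine hmem x ?_
    by_contra! h
    exact hx (max_eq_left (by linarith))
  have hχU : ∀ x ∈ U, 1 / 2 ≤ χ x := by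
    intro x hx
    have h1 := hN₁small (by positivity) (hUs x hx)
    have h2 : 1 / (24 * b) * b = 1 / 24 := by field_simp
    rw [h2] at h1
    exact le_max_of_le_right (by linarith)
  have hχd : ∀ g x, |χ (g⁻¹ * x) - χ x| ≤ 2 * N₁ g := by
    intro g x
    refine (abs_max_sub_max_le_max _ _ _ _).trans ?_
    rw [sub_self, abs_zero]
    refine max_le (by linarith [hN₁0 g]) ?_
    have h1 := hN₁mul g⁻¹ x
    have h2 := hN₁mul g (g⁻¹ * x)
    rw [mul_inv_cancel_left] at h2
    rw [hN₁inv] at h1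
    rw [abs_le]
    constructor <;> linarith
  set T := localAvg U χ with hT
  have hTs : T.IsSymmetric := isSymmetric_localAvg χ hU
  obtain ⟨D, e, l, θ', hD, he, hel, hl, hθ'1, hθ'2, hperp⟩ := exists_spectral_gap hTs
    (fun w => by rw [hT, inner_localAvg _ hU]; positivity) (Ω := Ωχ)
    (fun w => support_mulOp_subset hχs _) hθ0
    ((trace_localAvg_le hU hUne hχ1 Ωχ).trans ((div_le_iff₀ hUc).2 ht)) hD₀
  set γ := θ / (2 * ((D₀ : ℝ) + 1)) with hγ
  have hγ0 : 0 < γ := by positivity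
  have hDD : (D : ℝ) ≤ D₀ := by exact_mod_cast hD
  set NV : G → ℝ := fun g => ∑ i, ‖tau g (e i) - e i‖ with hNV
  have hNV0 : ∀ g, 0 ≤ NV g := fun g => Finset.sum_nonneg fun _ _ => norm_nonneg _
  have hNVmem : ∀ g, NV g ≤ 1 / 4 → g ∈ U ^ 6 := by
    intro g hg
    set ξ := restrict U fun _ => (1 : ℝ) with hξ
    have hξn : ‖ξ‖ ^ 2 = U.card := norm_indicator U
    have hξ0 : 0 < ‖ξ‖ := by
      by_contra! h
      have : ‖ξ‖ = 0 := le_antisymm h (norm_nonneg _)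
      rw [this] at hξn
      linarith
    have hξx : ∀ x, 0 ≤ ξ x := fun x => by
      by_cases h : x ∈ U
      · rw [hξ, restrict_apply_of_mem h]; exact zero_le_one
      · rw [hξ, restrict_apply_of_notMem h]
    have h1 : (1 / 2 * U.card) ^ 2 ≤ ‖avg U (mulOp χ ξ)‖ ^ 2 * ((U * U).card : ℝ) :=
      sq_le_norm_avg_sq_mul_card hU hUne (by norm_num)
        (fun x => by rw [mulOp_apply]; exact mul_nonneg (hχ0 x) (hξx x))
        fun x hx => by
          rw [mulOp_apply, hξ, restrict_apply_of_mem hx, mul_one]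
          exact hχU x hx
    have h2 : ‖avg U (mulOp χ ξ)‖ ^ 2 ≤ ‖ξ‖ * ‖T ξ‖ := by
      rw [← inner_localAvg _ hU]
      exact real_inner_le_norm _ _
    have h3 : 8 * θ * ‖ξ‖ ≤ ‖T ξ‖ := by
      have h4 : (1 / 2 * (U.card : ℝ)) ^ 2 ≤ ‖ξ‖ * ‖T ξ‖ * (R * U.card) :=
        h1.trans (mul_le_mul h2 hUU (by positivity) (by positivity))
      rw [← hξn] at h4
      have h5 : ‖ξ‖ ^ 3 * ‖ξ‖ ≤ ‖ξ‖ ^ 3 * (4 * R * ‖T ξ‖) := by linarith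
      have h6 := le_of_mul_le_mul_left h5 (by positivity)
      rw [hθ, ← mul_div_assoc, div_mul_eq_mul_div, div_le_iff₀ (by positivity)]
      linarith
    set u := T ξ with hu
    have hu0 : 0 < ‖u‖ := lt_of_lt_of_le (by positivity) h3
    have hr : ‖u - proj e u‖ ≤ ‖u‖ / 8 := by
      rw [hu, ← map_proj hTs hel, ← map_sub]
      have h4 := hperp _ (inner_sub_proj he ξ)
      have h5 : (θ' - γ) * ‖ξ - proj e ξ‖ ≤ θ * ‖ξ‖ :=
        mul_le_mul (by linarith) (norm_sub_proj_le he ξ) (norm_nonneg _) hθ0.le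
      linarith
    have hus : u.support ⊆ U ^ 3 := by
      have : (mulOp χ ξ).support ⊆ U := by
        intro x hx
        refine support_restrict_subset U (fun _ => (1 : ℝ)) ?_
        rw [Finsupp.mem_support_iff, mulOp_apply] at hx
        exact Finsupp.mem_support_iff.2 (right_ne_zero_of_mul hx)
      intro x hx
      rw [hu, hT, localAvg_apply, Finsupp.mem_support_iff, mulOp_apply] at hx
      have := support_avg_subset hU (support_avg_subset hU this)
        (Finsupp.mem_support_iff.2 (right_ne_zero_of_mul hx))
      rwa [pow_succ, sq]
    have hinv : (U ^ 3)⁻¹ = U ^ 3 := by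
      rw [← inv_pow, show U⁻¹ = U from ?_]
      ext x
      rw [Finset.mem_inv']
      exact ⟨fun h => by simpa using hU _ h, hU x⟩
    have hmem6 := mem_mul_inv_of_norm_tau_sub_lt hus (g := g) (by
      have e1 : tau g u - u = (tau g (proj e u) - proj e u) +
          (tau g (u - proj e u) - (u - proj e u)) := by
        rw [map_sub]; abel
      have h4 := norm_tau_proj_sub_le he g u
      have h5 := norm_sub_le (tau g (u - proj e u)) (u - proj e u)
      rw [norm_tau] at h5
      have h6 : ‖tau g u - u‖ ≤ ‖u‖ / 2 := by
        rw [e1]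
        refine (norm_add_le _ _).trans ?_
        have := mul_le_mul_of_nonneg_right hg hu0.le
        simp only [hNV] at this
        linarith
      have h7 := pow_le_pow_left₀ (norm_nonneg _) h6 2
      nlinarith)
    rwa [hinv, ← pow_add] at hmem6
  have hU6 : ∀ g ∈ U ^ 6, Small A Ω (1 / (4 * b)) g := by
    have key : ∀ n : ℕ, ∀ g ∈ U ^ n, Small A Ω (n * (1 / (24 * b))) g := by
      intro n
      induction n with
      | zero =>
        intro g hg
        rw [pow_zero, Finset.mem_one] at hg
        rw [hg]
        exact small_one (by simp)
      | succ n ih =>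
        intro g hg
        rw [pow_succ] at hg
        obtain ⟨x, hx, y, hy, rfl⟩ := Finset.mem_mul.1 hg
        exact ((ih x hx).mul (hUs y hy)).mono (le_of_eq (by push_cast; ring))
    exact fun g hg => (key 6 g hg).mono (le_of_eq (by field_simp; norm_num))
  have hrem : ∀ g i, ‖tau g (e i) - proj e (tau g (e i))‖ ≤ 4 * N₁ g / γ := by
    intro g i
    refine (norm_sub_proj_le_of_gap he hTs hel hγ0 hperp (hl i) _).trans ?_
    refine div_le_div_of_nonneg_right ?_ hγ0.le
    rw [← map_smul, ← hel]
    refine (norm_localAvg_tau_sub_le hχ1 (by linarith [hN₁0 g]) (hχd g) (e i)).trans_eq ?_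
    rw [he.1 i]; ring
  have hcommV : ∀ g h i, ‖tau h (tau g (e i) - e i) - (tau g (e i) - e i)‖ ≤
      NV h * ‖tau g (e i) - e i‖ + 8 * N₁ g / γ := by
    intro g h i
    set d := tau g (e i) - e i with hd
    have hdr : d - proj e d = tau g (e i) - proj e (tau g (e i)) := by
      rw [hd, proj_sub, proj_apply_self he]; abel
    have h1 := hrem g i
    rw [← hdr] at h1
    clear_value d
    have e1 : tau h d - d = (tau h (proj e d) - proj e d) +
        (tau h (d - proj e d) - (d - proj e d)) := by
      rw [map_sub]; abel
    have h4 := norm_tau_proj_sub_le he h d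
    have h5 := norm_sub_le (tau h (d - proj e d)) (d - proj e d)
    rw [norm_tau] at h5
    rw [e1]
    refine (norm_add_le _ _).trans ((add_le_add h4 (h5.trans (add_le_add h1 h1))).trans_eq ?_)
    ring
  have hM1 : 1 ≤ M := by rw [hM]; linarith [show 0 ≤ 64 * (D₀ : ℝ) * (D₀ + 1) / θ by positivity]
  have hM0 : 0 ≤ M := zero_le_one.trans hM1
  have hMγ : M = 1 + 32 * D₀ / γ := by
    rw [hM, hγ, div_div_eq_mul_div]; ring
  refine ⟨fun g => M * N₁ g + NV g, fun g => ?_, ?_, fun g => ?_, fun g h => ?_, ?_, ?_, ?_⟩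
  · exact add_nonneg (mul_nonneg hM0 (hN₁0 g)) (hNV0 g)
  · simp [hN₁, hNV, tau_one]
  · simp only [hN₁, hNV, norm_tau_inv_sub]
  · have h1 := mul_le_mul_of_nonneg_left (hN₁mul g h) hM0
    have h2 : NV (g * h) ≤ NV g + NV h := by
      simp only [hNV, ← Finset.sum_add_distrib]
      exact Finset.sum_le_sum fun i _ => norm_tau_mul_sub_le g h _
    simp only
    linarith
  · intro g n hn
    have hNVi : ∀ i ≤ n, NV (g ^ i) ≤ 1 / 4 := fun i hi => by
      have := mul_nonneg hM0 (hN₁0 (g ^ i))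
      linarith [hn i hi]
    rcases Nat.eq_zero_or_pos n with rfl | hn0
    · rw [Nat.cast_zero, zero_div, zero_mul]
      exact add_nonneg (mul_nonneg hM0 (hN₁0 _)) (hNV0 _)
    have hg1 : N₁ g ≤ 1 := by
      have := hn 1 hn0
      rw [pow_one] at this
      have h2 : 1 * N₁ g ≤ M * N₁ g := mul_le_mul_of_nonneg_right hM1 (hN₁0 g)
      linarith [hNV0 g]
    have k1 : n * (N₁ g - 1 / 4 * N₁ g) ≤ N₁ (g ^ n) := by
      refine le_norm_tau_pow_sub fun i hi => ?_
      refine (hcomm (by positivity) (hU6 _ (hNVmem _ (hNVi i hi.le))) hg1).trans_eq ?_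
      field_simp
    have k2 : ∀ i, n * (‖tau g (e i) - e i‖ - (1 / 4 * ‖tau g (e i) - e i‖ + 8 * N₁ g / γ)) ≤
        ‖tau (g ^ n) (e i) - e i‖ := by
      intro i
      refine le_norm_tau_pow_sub fun j hj => (hcommV g (g ^ j) i).trans ?_
      have := mul_le_mul_of_nonneg_right (hNVi j hj.le) (norm_nonneg (tau g (e i) - e i))
      linarith
    have k3 : n * (3 / 4 * NV g - D * (8 * N₁ g / γ)) ≤ NV (g ^ n) := by
      refine le_trans (le_of_eq ?_) (Finset.sum_le_sum fun i _ => k2 i)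
      simp only [hNV, ← Finset.mul_sum, Finset.sum_sub_distrib, Finset.sum_add_distrib,
        Finset.sum_const, Finset.card_univ, Fintype.card_fin, nsmul_eq_mul]
      ring
    have k4 : D * (8 * N₁ g / γ) ≤ M * N₁ g / 4 := by
      have a1 : D * (8 * N₁ g / γ) ≤ D₀ * (8 * N₁ g / γ) :=
        mul_le_mul_of_nonneg_right hDD (div_nonneg (by linarith [hN₁0 g]) hγ0.le)
      have a2 : D₀ * (8 * N₁ g / γ) = (M - 1) * N₁ g / 4 := by rw [hMγ]; ring
      linarith [hN₁0 g]
    have k5 := mul_le_mul_of_nonneg_left k1 hM0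
    have hn' : (0 : ℝ) ≤ n := by positivity
    have k6 := mul_le_mul_of_nonneg_left k4 hn'
    have k7 := mul_nonneg hn' (hNV0 g)
    simp only
    linarith
  · intro g hg
    have := mul_nonneg hM0 (hN₁0 g)
    exact hNVmem g (by linarith)
  · intro δ h hδ hA' hU'
    have k1 := hN₁small hδ hA'
    have k2 : ∀ i, ‖tau h (e i) - e i‖ ≤ 2 * (δ * (2 * b + 1)) / θ := by
      intro i
      have a1 := norm_tau_localAvg_sub_le (U := U) hχ1 hχs (by linarith [hN₁0 h]) hδ (hχd h) hU'
        (e i)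
      rw [he.1 i, mul_one, ← hT, hel, map_smul, ← smul_sub, norm_smul, Real.norm_eq_abs] at a1
      have a2 : θ / 2 ≤ |l i| := le_trans (by linarith [hl i]) (le_abs_self _)
      have a3 := mul_le_mul_of_nonneg_right a2 (norm_nonneg (tau h (e i) - e i))
      rw [le_div_iff₀ hθ0]
      linarith
    have k3 : NV h ≤ D₀ * (2 * (δ * (2 * b + 1)) / θ) := by
      refine (Finset.sum_le_card_nsmul _ _ _ fun i _ => k2 i).trans ?_
      rw [Finset.card_univ, Fintype.card_fin, nsmul_eq_mul]
      exact mul_le_mul_of_nonneg_right hDD (by positivity)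
    have k4 := mul_le_mul_of_nonneg_left k1 hM0
    refine (add_le_add k4 k3).trans_eq ?_
    ring

theorem exists_large_small_finset.{u} (K C₁ p q : ℕ) {δ : ℝ} (hδ : 0 < δ) :
    ∃ C : ℕ, ∀ (G : Type u) [Group G] [DecidableEq G] (A U : Finset G), 1 ∈ A →
      (∀ j, (A ^ (j + 1)).card ≤ K ^ j * A.card) → (∀ a ∈ A, a⁻¹ ∈ A) →
      U ⊆ A ^ 2 → U.Nonempty → (∀ u ∈ U, u⁻¹ ∈ U) → A.card ≤ C₁ * U.card →
      ∃ S : Finset G, A.card ≤ C * S.card ∧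
        ∀ s ∈ S, s ∈ A ^ 2 ∧ Small A (A ^ p) δ s ∧ Small U (A ^ q) δ s := by
  obtain ⟨C₂, -, h₂⟩ := exists_large_small_subset.{u} ((K ^ (p + 1) : ℕ) : ℝ) hδ
  obtain ⟨C₃, -, h₃⟩ := exists_large_small_subset.{u} ((K ^ (q + 2) * C₁ : ℕ) : ℝ) hδ
  refine ⟨C₂ * C₃, fun G _ _ A U hone hgrow hA hUA hUne hU hAU => ?_⟩
  have hmono : ∀ {a b : ℕ}, a ≤ b → A ^ a ⊆ A ^ b := fun h => Finset.pow_subset_pow_right hone h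
  obtain ⟨S₂, hS₂A, hS₂c, hS₂⟩ := h₂ G A (A ^ p) (A ^ (p + 1 + 1)) A ⟨1, hone⟩ hA
    (hmono (by omega)) (by rw [← pow_succ, ← pow_succ']) (by exact_mod_cast hgrow (p + 1))
  obtain ⟨S₃, hS₃S, hS₃c, hS₃⟩ := h₃ G S₂ (A ^ q) (A ^ (q + 2 + 1)) U hUne hU
    (hmono (by omega))
    (by
      rw [pow_succ' A, pow_add]
      exact Finset.mul_subset_mul hS₂A (Finset.mul_subset_mul_left hUA))
    (by
      have h1 := hgrow (q + 2)
      have h2 : (A ^ (q + 2 + 1)).card ≤ K ^ (q + 2) * C₁ * U.card :=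
        h1.trans (by rw [mul_assoc]; exact Nat.mul_le_mul_left _ hAU)
      exact_mod_cast h2)
  have hpos : 0 < A.card := Finset.card_pos.2 ⟨1, hone⟩
  have hAc : A.card ≤ C₂ * C₃ * S₃.card :=
    hS₂c.trans (by rw [mul_assoc]; exact Nat.mul_le_mul_left _ hS₃c)
  obtain ⟨s₀, hs₀⟩ : S₃.Nonempty := by
    rw [Finset.nonempty_iff_ne_empty]
    rintro rfl
    rw [Finset.card_empty, mul_zero] at hAc
    omega
  refine ⟨s₀⁻¹ • S₃, by rwa [Finset.card_smul_finset], fun s hs => ?_⟩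
  obtain ⟨x, hx, rfl⟩ := Finset.mem_smul_finset.1 hs
  refine ⟨?_, hS₂ s₀ (hS₃S hs₀) x (hS₃S hx), hS₃ s₀ hs₀ x hx⟩
  rw [sq]
  exact Finset.mul_mem_mul (hA _ (hS₂A (hS₃S hs₀))) (hS₂A (hS₃S hx))

theorem card_pow_succ_le {G : Type*} [Group G] [DecidableEq G] {A X : Finset G} {K : ℕ}
    (hX : X.card ≤ K) (hAX : A * A ⊆ X * A) (j : ℕ) : (A ^ (j + 1)).card ≤ K ^ j * A.card := by
  have h : A ^ (j + 1) ⊆ X ^ j * A := by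
    induction j with
    | zero => simp
    | succ j ih =>
      rw [pow_succ]
      refine (Finset.mul_subset_mul_right ih).trans ?_
      rw [mul_assoc, pow_succ X, mul_assoc]
      exact Finset.mul_subset_mul_left hAX
  refine (Finset.card_le_card h).trans (Finset.card_mul_le.trans ?_)
  exact Nat.mul_le_mul_right _ (Finset.card_pow_le.trans (Nat.pow_le_pow_left hX j))

theorem doublingControl.{u} : DoublingControl.{u} := by
  classical
  intro K
  set m := 12 * K + 2 with hm
  set b : ℝ := 2 * K + 1 with hb
  have hb1 : 1 ≤ b := by
    have : (0 : ℝ) ≤ K := Nat.cast_nonneg K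
    linarith
  obtain ⟨C₁, h₁⟩ := exists_large_small_finset.{u} K 1 (3 * m + 4) (3 * m + 4)
    (δ := 1 / (24 * b)) (by positivity)
  set t : ℝ := K ^ (2 * m + 3) * C₁ with ht
  set R : ℝ := K ^ 3 * C₁ + 1 with hR
  have hR0 : 0 < R := by positivity
  set θ : ℝ := 1 / (32 * R) with hθ
  obtain ⟨D₀, hD₀⟩ := exists_nat_ge (2 * t / θ)
  set M : ℝ := 1 + 64 * D₀ * (D₀ + 1) / θ with hM
  set L : ℝ := M * b + 2 * D₀ * (2 * b + 1) / θ with hL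
  have hθ0 : 0 < θ := by positivity
  have hL0 : 0 < L := by positivity
  obtain ⟨C₂, h₂⟩ := exists_large_small_finset.{u} K C₁ (3 * m + 4) (2 * m + 4)
    (δ := 1 / 128 / L) (by positivity)
  set C : ℝ := K ^ 11 * C₂ + 1 with hC
  have hC1 : 1 ≤ C := by
    have : (0 : ℝ) ≤ K ^ 11 * C₂ := by positivity
    linarith
  obtain ⟨C₃, h₃⟩ := exists_large_small_finset.{u} K C₁ (3 * m + 4) (2 * m + 4)
    (δ := 1 / 64 / (1024 * C) / L) (by positivity)
  refine ⟨K ^ 2 * C₃, ?_⟩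
  rintro G _ _ A hone hA ⟨X, hX, hAX⟩
  have hgrow := card_pow_succ_le hX hAX
  have hmono : ∀ {a b : ℕ}, a ≤ b → A ^ a ⊆ A ^ b := fun h => Finset.pow_subset_pow_right hone h
  have hApos : 0 < A.card := Finset.card_pos.2 ⟨1, hone⟩
  have hAinv : A⁻¹ = A := by
    ext x
    rw [Finset.mem_inv']
    exact ⟨fun h => by simpa using hA _ h, hA x⟩
  have hpinv : ∀ (n : ℕ) (x : G), x ∈ A ^ n → x⁻¹ ∈ A ^ n := fun n x hx => by
    rw [← Finset.mem_inv', ← inv_pow, hAinv]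
    exact hx
  set U := (A ^ 2).filter (Small A (A ^ (3 * m + 4)) (1 / (24 * b))) with hU
  have hU1 : 1 ∈ U := Finset.mem_filter.2 ⟨Finset.one_mem_pow hone, small_one (by positivity)⟩
  have hUinv : ∀ u ∈ U, u⁻¹ ∈ U := fun u hu => by
    rw [hU, Finset.mem_filter] at hu ⊢
    exact ⟨hpinv 2 u hu.1, hu.2.inv⟩
  have hUA : U ⊆ A ^ 2 := Finset.filter_subset _ _
  have hAU : A.card ≤ C₁ * U.card := by
    obtain ⟨S, hSc, hS⟩ := h₁ G A A hone hgrow hA (by simpa using hmono (show 1 ≤ 2 by omega))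
      ⟨1, hone⟩ hA (by simp)
    refine hSc.trans (Nat.mul_le_mul_left _ (Finset.card_le_card fun s hs => ?_))
    exact Finset.mem_filter.2 ⟨(hS s hs).1, (hS s hs).2.1⟩
  have hAU' : (A.card : ℝ) ≤ C₁ * U.card := by exact_mod_cast hAU
  have hgrow' : ∀ j, ((A ^ (j + 1)).card : ℝ) ≤ K ^ j * A.card := fun j => by
    exact_mod_cast hgrow j
  obtain ⟨f, hφ1, hfs, hfb, hder⟩ := exists_gleason_function hA hone (K := K)
    (by simpa [sq] using hgrow 1)
  obtain ⟨N, hN0, hN1, hNinv, hNmul, hesc, hNU, hNs⟩ := exists_escapeNorm_of_averaging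
    (A := A) (U := U) (Ω := A ^ (3 * m + 4)) (Ωf := A ^ m) (Ωχ := A ^ (2 * m + 4)) hA hb1 hfs hφ1
    (hfb.trans (by linarith))
    (fun g => (hder g).trans (mul_le_mul_of_nonneg_right (by linarith) (norm_nonneg _)))
    (by
      have e : A ^ m * A * A = A ^ (m + 2) := by rw [mul_assoc, ← sq, ← pow_add]
      rw [e, ← inv_pow, hAinv, ← pow_add]
      exact hmono (by omega))
    (hmono (by omega)) (by rw [← pow_add]; exact hmono (by omega))
    hUinv hU1 (fun u hu => (Finset.mem_filter.1 hu).2) hR0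
    (by
      refine (hgrow' (2 * m + 3)).trans ?_
      rw [ht, mul_assoc]
      exact mul_le_mul_of_nonneg_left hAU' (by positivity))
    (by
      have h1 : (U * U).card ≤ (A ^ (3 + 1)).card := Finset.card_le_card (by
        rw [show 3 + 1 = 2 + 2 from rfl, pow_add]
        exact Finset.mul_subset_mul hUA hUA)
      have h2 : ((U * U).card : ℝ) ≤ (A ^ (3 + 1)).card := by exact_mod_cast h1
      refine h2.trans ((hgrow' 3).trans ?_)
      have h3 := mul_le_mul_of_nonneg_left hAU' (by positivity : (0 : ℝ) ≤ K ^ 3)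
      have h4 : (0 : ℝ) ≤ U.card := by positivity
      rw [hR]
      linarith)
    hθ hD₀ hM
  have hNA : ∀ g, N g ≤ 1 / 4 → g ∈ A ^ 12 := fun g hg => by
    have h := Finset.pow_subset_pow_left (n := 6) hUA (hNU g hg)
    rwa [← pow_mul] at h
  obtain ⟨S₂, hS₂c, hS₂⟩ := h₂ G A U hone hgrow hA hUA ⟨1, hU1⟩ hUinv hAU
  obtain ⟨S₃, hS₃c, hS₃⟩ := h₃ G A U hone hgrow hA hUA ⟨1, hU1⟩ hUinv hAU
  have hN₂ : ∀ s ∈ S₂, N s ≤ 1 / 64 / 2 := fun s hs => by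
    refine (hNs _ s (by positivity) (hS₂ s hs).2.1 (hS₂ s hs).2.2).trans_eq ?_
    rw [← hL, div_mul_cancel₀ _ hL0.ne']
    norm_num
  have hN₃ : ∀ s ∈ S₃, N s ≤ 1 / 64 / (1024 * C) := fun s hs => by
    refine (hNs _ s (by positivity) (hS₃ s hs).2.1 (hS₃ s hs).2.2).trans_eq ?_
    rw [← hL, div_mul_cancel₀ _ hL0.ne']
  have hsub : ∀ r : ℝ, r ≤ 1 / 4 → {g | N g ≤ r} ⊆ (A ^ 12 : Finset G) := fun r hr g hg =>
    hNA g (le_trans hg hr)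
  have hfin : ∀ r : ℝ, r ≤ 1 / 4 → {g | N g ≤ r}.Finite := fun r hr =>
    (Finset.finite_toSet _).subset (hsub r hr)
  refine ⟨_, isVirtuallyNilpotent_of_escapeNorm hN0 hN1 hNinv hNmul (c₀ := 1 / 4) (c := 1 / 64)
    (C := C) (by norm_num) hesc (by norm_num) (by norm_num) (hfin _ (by norm_num)) hC1 ?_, ?_⟩
  · have h1 : {g | N g ≤ 2 * (1 / 64 : ℝ)}.ncard ≤ (A ^ (11 + 1)).card := by
      rw [← Set.ncard_coe_finset]
      exact Set.ncard_le_ncard (hsub _ (by norm_num)) (Finset.finite_toSet _)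
    have h2 : S₂.card ≤ {g | N g ≤ 1 / 64 / 2}.ncard := by
      rw [← Set.ncard_coe_finset]
      exact Set.ncard_le_ncard hN₂ (hfin _ (by norm_num))
    have h3 : {g | N g ≤ 2 * (1 / 64 : ℝ)}.ncard ≤
        K ^ 11 * (C₂ * {g | N g ≤ 1 / 64 / 2}.ncard) :=
      h1.trans ((hgrow 11).trans (Nat.mul_le_mul_left _
        (hS₂c.trans (Nat.mul_le_mul_left _ h2))))
    have h4 : ({g | N g ≤ 2 * (1 / 64 : ℝ)}.ncard : ℝ) ≤
        K ^ 11 * (C₂ * {g | N g ≤ 1 / 64 / 2}.ncard) := by exact_mod_cast h3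
    refine h4.trans ?_
    rw [hC, ← mul_assoc]
    exact mul_le_mul_of_nonneg_right (by linarith) (by positivity)
  · have hS₃ne : S₃.Nonempty := by
      rw [Finset.nonempty_iff_ne_empty]
      rintro rfl
      rw [Finset.card_empty, mul_zero] at hS₃c
      omega
    have h1 : (A * S₃).card ≤ (A ^ (2 + 1)).card := Finset.card_le_card (by
      rw [pow_succ']
      exact Finset.mul_subset_mul_left fun s hs => (hS₃ s hs).1)
    have h2 : (A * S₃).card ≤ K ^ 2 * C₃ * S₃.card :=
      h1.trans ((hgrow 2).trans (by rw [mul_assoc]; exact Nat.mul_le_mul_left _ hS₃c))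
    obtain ⟨F, -, hF, hAF⟩ := Finset.ruzsa_covering_mul hS₃ne
      (K := ((K ^ 2 * C₃ : ℕ) : ℝ)) (by exact_mod_cast h2)
    refine ⟨F, by exact_mod_cast hF, fun a ha => ?_⟩
    obtain ⟨y, hy, z, hz, rfl⟩ := Finset.mem_mul.1 (hAF ha)
    obtain ⟨p, hp, q, hq, rfl⟩ := Finset.mem_div.1 hz
    exact Set.mul_mem_mul hy (Subgroup.div_mem _ (Subgroup.subset_closure (hN₃ p hp))
      (Subgroup.subset_closure (hN₃ q hq)))

end FinsuppHilbert

end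

/-- **Generalized Margulis lemma.** For every `K ≥ 1` there is `ε₀ > 0` such that:
if `X` is a metric space in which every ball of radius `4` can be covered by at most `K`
balls of radius `1`, and `Γ` is a subgroup of the isometry group of `X` such that
`S₂(x) = {γ ∈ Γ : d(γx,x) < 2}` is finite for every `x`, then for every `x ∈ X` and
`0 < ε < ε₀` the subgroup generated by `S_ε(x) = {γ ∈ Γ : d(γx,x) < ε}` is virtually
nilpotent. -/
theorem generalized_margulis_lemma :
    ∀ K : ℝ, 1 ≤ K → ∃ ε₀ : ℝ, 0 < ε₀ ∧
      ∀ (X : Type*) [MetricSpace X],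
        (∀ x : X, ∃ T : Finset X, (T.card : ℝ) ≤ K ∧
            Metric.ball x 4 ⊆ ⋃ y ∈ T, Metric.ball y 1) →
        ∀ Γ : Subgroup (X ≃ᵢ X),
          (∀ x : X, {γ : X ≃ᵢ X | γ ∈ Γ ∧ dist (γ x) x < 2}.Finite) →
          ∀ (x : X) (ε : ℝ), 0 < ε → ε < ε₀ →
            IsVirtuallyNilpotent
              (Subgroup.closure {γ : X ≃ᵢ X | γ ∈ Γ ∧ dist (γ x) x < ε}) := by
  intro K hK
  exact generalized_margulis_of_control FinsuppHilbert.doublingControl K hK
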